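/- arXiv:2602.09298 — 9 statements merged into one kernel-verified Lean document; each statement's English description precedes it below -/
import Mathlib

section
/- Let p be a prime, let K be a field of characteristic p, and let a, b, c, d, e ∈ K with a ≠ 0 and c − a·b ≠ 0. Define a' = (c + d)·a/(c − a·b) − a + b − e − c/a and b' = (d + a·b)·a/(c − a·b). Then I_p(a', b', c + 1, d, e) = I_p(a, b, c, d, e). (The polynomial I_p is invariant under the translation T₁ of the difference second Painlevé equation dP₂.) -/
open MvPolynomial

noncomputable section

/-- The polynomial ring `R = 𝔽_p[f, g, α₁, α₂, t]`, with the five indeterminates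
indexed by `0, 1, 2, 3, 4` respectively. -/
abbrev R (p : ℕ) := MvPolynomial (Fin 5) (ZMod p)

def fP (p : ℕ) : R p := X 0
def gP (p : ℕ) : R p := X 1
def a1P (p : ℕ) : R p := X 2
def a2P (p : ℕ) : R p := X 3
def tP (p : ℕ) : R p := X 4

/-- `h = f·g·(t·g − 1)·(t·f − 1) + α₁·(t·g − 1) − α₂·(t·f − 1)`. -/
def hP (p : ℕ) : R p :=
  fP p * gP p * (tP p * gP p - 1) * (tP p * fP p - 1)
    + a1P p * (tP p * gP p - 1) - a2P p * (tP p * fP p - 1)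

def A0 (p : ℕ) : Matrix (Fin 2) (Fin 2) (R p) :=
  !![-(a1P p) * gP p + fP p * gP p ^ 2 - tP p * fP p ^ 2 * gP p ^ 2, -(fP p * gP p);
     fP p * gP p * hP p - a1P p * a2P p, -(a2P p) * fP p - fP p ^ 2 * gP p + tP p * fP p ^ 2 * gP p ^ 2]

def A1 (p : ℕ) : Matrix (Fin 2) (Fin 2) (R p) := !![0, 1; hP p, 0]

def A2 (p : ℕ) : Matrix (Fin 2) (Fin 2) (R p) :=
  !![tP p, 0; 1 - tP p ^ 2 * fP p * gP p, -(tP p)]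

def A3 (p : ℕ) : Matrix (Fin 2) (Fin 2) (R p) := !![0, 0; -(tP p ^ 2), 0]

/-- The Lax coefficient matrix `A(z) = A₀ + z·A₁ + z²·A₂ + z³·A₃`, with entries in any
commutative ring `S` receiving a ring homomorphism from `R`. -/
def AM (p : ℕ) {S : Type*} [CommRing S] (φ : R p →+* S) (z : S) : Matrix (Fin 2) (Fin 2) S :=
  (A0 p).map φ + z • (A1 p).map φ + z ^ 2 • (A2 p).map φ + z ^ 3 • (A3 p).map φ

/-- The integral of motion `I_p = Tr[A(p−1)·A(p−2)·⋯·A(1)·A(0)] ∈ R`. -/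
def Ip (p : ℕ) : R p :=
  Matrix.trace (((List.range p).reverse.map (fun k => AM p (RingHom.id (R p)) (k : R p))).prod)

/-- Evaluation of a polynomial `P ∈ R` at a point `(a,b,c,d,e) ∈ K⁵` of a field (or
commutative ring) of characteristic `p`. -/
def evalP (p : ℕ) (P : R p) (K : Type*) [CommRing K] [CharP K p] (a b c d e : K) : K :=
  eval₂ (ZMod.castHom (dvd_refl p) K) ![a, b, c, d, e] P

end

section Lax

variable {S : Type*} [CommRing S]

/-- The value of `h` at the point `(f, g, α, β, t)`. -/
def laxH (f g α β t : S) : S :=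
  f * g * (t * g - 1) * (t * f - 1) + α * (t * g - 1) - β * (t * f - 1)

/-- The Lax matrix `A(z)` at the point `(f, g, α, β, t)`. -/
def lax (f g α β t z : S) : Matrix (Fin 2) (Fin 2) S :=
  !![-α * g + f * g ^ 2 - t * f ^ 2 * g ^ 2 + z ^ 2 * t, -(f * g) + z;
     f * g * laxH f g α β t - α * β + z * laxH f g α β t
       + z ^ 2 * (1 - t ^ 2 * f * g) - z ^ 3 * t ^ 2,
     -β * f - f ^ 2 * g + t * f ^ 2 * g ^ 2 - z ^ 2 * t]

/-- The gauge matrix intertwining the Lax matrices at a point and at its translate; here `u` and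
`v` are the products `f * g` at the point and at its translate, and `g'` is the translated `g`. -/
def laxGauge (u v g' α t z : S) : Matrix (Fin 2) (Fin 2) S :=
  !![-g' + t * v + t * z, 1;
     (-g' + t * v + t * z) * (-g' - t * (u - 1) - t * z) + (z - α - 1),
     -g' - t * (u - 1) - t * z]

lemma det_laxGauge (u v g' α t z : S) : (laxGauge u v g' α t z).det = α + 1 - z := by
  rw [laxGauge, Matrix.det_fin_two_of]
  ring

/-- The ordered product `A(s + n - 1) ⋯ A(s + 1) A(s)`. -/
def shiftProd {M : Type*} [Monoid M] (A : S → M) (s : S) (n : ℕ) : M :=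
  ((List.range n).reverse.map fun k : ℕ => A (s + (k : S))).prod

lemma shiftProd_zero {M : Type*} [Monoid M] (A : S → M) (s : S) : shiftProd A s 0 = 1 := rfl

lemma shiftProd_succ {M : Type*} [Monoid M] (A : S → M) (s : S) (n : ℕ) :
    shiftProd A s (n + 1) = A (s + n) * shiftProd A s n := by
  simp [shiftProd, List.range_succ]

lemma shiftProd_succ_right {M : Type*} [Monoid M] (A : S → M) (s : S) (n : ℕ) :
    shiftProd A s (n + 1) = shiftProd A (s + 1) n * A s := by
  induction n with
  | zero => simp [shiftProd]
  | succ n ih =>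
    rw [shiftProd_succ, ih, shiftProd_succ, mul_assoc]
    push_cast
    ring_nf

/-- A gauge transformation of difference systems intertwines the ordered products. -/
lemma gauge_mul_shiftProd {M : Type*} [Monoid M] {A A' C : S → M}
    (h : ∀ z, C (z + 1) * A' z = A z * C z) (s : S) (n : ℕ) :
    C (s + n) * shiftProd A' s n = shiftProd A s n * C s := by
  induction n with
  | zero => simp [shiftProd_zero]
  | succ n ih =>
    rw [shiftProd_succ, shiftProd_succ, mul_assoc, ← ih, ← mul_assoc, ← mul_assoc, ← h]
    push_cast
    rw [add_assoc]

/-- In characteristic `n`, the trace of the ordered product over a full period does not depend on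
the starting point. -/
lemma trace_shiftProd_add_one {ι : Type*} [Fintype ι] [DecidableEq ι] (n : ℕ) [CharP S n]
    (A : S → Matrix ι ι S) (s : S) :
    (shiftProd A (s + 1) n).trace = (shiftProd A s n).trace := by
  cases n with
  | zero => rfl
  | succ m =>
    have hm : s + 1 + (m : S) = s := by
      have := CharP.cast_eq_zero S (m + 1)
      push_cast at this
      linear_combination this
    rw [shiftProd_succ, shiftProd_succ_right, hm, Matrix.trace_mul_comm]

/-- In characteristic `n`, gauge equivalent difference systems have ordered products over a full
period with the same trace. -/
lemma trace_shiftProd_eq_of_gauge {ι : Type*} [Fintype ι] [DecidableEq ι] (n : ℕ) [CharP S n]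
    {A A' C : S → Matrix ι ι S} (h : ∀ z, C (z + 1) * A' z = A z * C z) {s : S}
    (hs : IsUnit (C s).det) :
    (shiftProd A' s n).trace = (shiftProd A s n).trace := by
  have key := gauge_mul_shiftProd h s n
  rw [CharP.cast_eq_zero, add_zero] at key
  rw [← Matrix.mul_nonsing_inv_cancel_right (C s) (shiftProd A s n) hs, ← key,
    Matrix.trace_mul_comm, Matrix.nonsing_inv_mul_cancel_left _ _ hs]

lemma evalP_Ip (p : ℕ) [CharP S p] (a b c d e : S) :
    evalP p (Ip p) S a b c d e = (shiftProd (lax a b c d e) 0 p).trace := by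
  let φ : R p →+* S := eval₂Hom (ZMod.castHom (dvd_refl p) S) ![a, b, c, d, e]
  have hφ (i : Fin 5) : φ (X i) = ![a, b, c, d, e] i := eval₂Hom_X' _ _ _
  have hA (k : ℕ) :
      φ.mapMatrix (AM p (RingHom.id (R p)) (k : R p)) = lax a b c d e (0 + (k : S)) := by
    ext i j
    fin_cases i <;> fin_cases j <;>
      simp [AM, A0, A1, A2, A3, hP, fP, gP, a1P, a2P, tP, lax, laxH, hφ] <;> ring
  change φ (Ip p) = _
  rw [Ip, shiftProd, AddMonoidHom.map_trace φ, ← RingHom.mapMatrix_apply, map_list_prod,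
    List.map_map, bind_pure_comp, List.map_eq_map, List.map_map]
  congr 2
  exact List.map_congr_left fun k _ => hA k

/-- The Lax matrices at a point and at its image under `T₁` are gauge equivalent. In terms of
`q = (c - a * b) / a` and the translated coordinate `b'`, the translation is polynomial. -/
lemma laxGauge_mul_lax (a b b' e q z : S) :
    laxGauge (a * b) ((b' - q - e) * b') b' (a * (q + b)) e (z + 1)
        * lax (b' - q - e) b' (a * (q + b) + 1) (b' * q - a * b) e z
      = lax a b (a * (q + b)) (b' * q - a * b) e z
        * laxGauge (a * b) ((b' - q - e) * b') b' (a * (q + b)) e z := by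
  ext i j
  fin_cases i <;> fin_cases j <;>
    simp [laxGauge, lax, laxH, Matrix.mul_apply, Fin.sum_univ_two] <;> ring

end Lax

/-- The integral of motion `I_p` is invariant under the translation `T₁`
of the difference second Painlevé equation `dP₂`. -/
theorem Ip_invariant_T1 (p : ℕ) (hp : p.Prime) (K : Type*) [Field K] [CharP K p]
    (a b c d e : K) (ha : a ≠ 0) (hcab : c - a * b ≠ 0) :
    evalP p (Ip p) K
      ((c + d) * a / (c - a * b) - a + b - e - c / a)
      ((d + a * b) * a / (c - a * b))
      (c + 1) d e
    = evalP p (Ip p) K a b c d e := by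
  rw [evalP_Ip, evalP_Ip]
  obtain ⟨q, hq⟩ : ∃ q, q = (c - a * b) / a := ⟨_, rfl⟩
  obtain ⟨b', hb'⟩ : ∃ b', b' = (d + a * b) * a / (c - a * b) := ⟨_, rfl⟩
  have ha' : (c + d) * a / (c - a * b) - a + b - e - c / a = b' - q - e := by
    rw [hq, hb']
    field_simp
    ring
  have hc' : c = a * (q + b) := by
    rw [hq]
    field_simp
    ring
  have hd' : d = b' * q - a * b := by
    rw [hq, hb']
    field_simp
    ring
  rw [ha', ← hb']
  have key := laxGauge_mul_lax a b b' e q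
  rw [← hc', ← hd'] at key
  by_cases hc : c + 1 = 0
  · rw [← trace_shiftProd_add_one, ← trace_shiftProd_add_one p (lax a b c d e)]
    refine trace_shiftProd_eq_of_gauge p key (IsUnit.mk0 _ ?_)
    rw [det_laxGauge, hc]
    simp
  · refine trace_shiftProd_eq_of_gauge p key (IsUnit.mk0 _ ?_)
    rwa [det_laxGauge, sub_zero]
end

section
/- Let p be a prime and let D : R → R be the unique 𝔽_p-linear derivation of R = 𝔽_p[f, g, α₁, α₂, t] determined by its values on the generators: D(f) = f·(2·g − f − t) − α₁, D(g) = g·(2·f − g + t) + α₂, D(α₁) = 0, D(α₂) = 0, D(t) = 1 (this is the vector field of the fourth Painlevé equation P_IV). Then D(I_p) = 0; that is, I_p is a polynomial integral of motion of the fourth Painlevé equation in characteristic p. -/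
open MvPolynomial

/-- The matrix `B(z)` describing the deformation of solutions of the difference equation
`Y(z + 1) = A(z) Y(z)` along the fourth Painlevé flow. -/
noncomputable def laxB (p : ℕ) (z : R p) : Matrix (Fin 2) (Fin 2) (R p) :=
  !![tP p * z + 2 * tP p * fP p * gP p - tP p, 1;
     -(tP p ^ 2) * z ^ 2 + (tP p ^ 2 - 2 * tP p ^ 2 * fP p * gP p) * z
       + hP p + fP p * gP p * (tP p ^ 2 - 2 * tP p ^ 2 * fP p * gP p),
     -(tP p * z)]

/-- The entrywise Leibniz rule for a product of matrices. -/
lemma Matrix.map_derivation_mul {k S n : Type*} [CommSemiring k] [CommSemiring S] [Algebra k S]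
    [Fintype n] (D : Derivation k S S) (M N : Matrix n n S) :
    (M * N).map D = M.map D * N + M * N.map D := by
  ext i j
  simp [Matrix.mul_apply, Finset.sum_add_distrib, mul_comm, add_comm]

/-- The Lax equation `D A(z) = B(z + 1) A(z) - A(z) B(z)`, for `z` a constant of `D`. -/
lemma map_derivation_AM (p : ℕ) (D : Derivation (ZMod p) (R p) (R p))
    (hf : D (fP p) = fP p * (2 * gP p - fP p - tP p) - a1P p)
    (hg : D (gP p) = gP p * (2 * fP p - gP p + tP p) + a2P p)
    (ha1 : D (a1P p) = 0) (ha2 : D (a2P p) = 0) (ht : D (tP p) = 1)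
    (z : R p) (hz : D z = 0) :
    (AM p (RingHom.id (R p)) z).map D =
      laxB p (z + 1) * AM p (RingHom.id (R p)) z - AM p (RingHom.id (R p)) z * laxB p z := by
  ext i j : 1
  fin_cases i <;> fin_cases j <;>
    simp [AM, A0, A1, A2, A3, laxB, hP,
      Derivation.leibniz_pow, hf, hg, ha1, ha2, ht, hz] <;> ring

/-- If `D A(k) = B(k + 1) A(k) - A(k) B(k)` for all `k`, the product `A(n - 1) ⋯ A(0)`
satisfies the telescoped equation. -/
lemma map_derivation_prod_of_lax {k S m : Type*} [CommSemiring k] [CommRing S] [Algebra k S]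
    [Fintype m] [DecidableEq m] (D : Derivation k S S) (A B : ℕ → Matrix m m S)
    (h : ∀ i, (A i).map D = B (i + 1) * A i - A i * B i) (n : ℕ) :
    (((List.range n).reverse.map A).prod).map D =
      B n * ((List.range n).reverse.map A).prod - ((List.range n).reverse.map A).prod * B 0 := by
  induction n with
  | zero =>
    ext i j
    by_cases hij : i = j <;> simp [hij]
  | succ n ih =>
    rw [List.range_succ, List.reverse_append, List.reverse_singleton, List.singleton_append,
      List.map_cons, List.prod_cons, Matrix.map_derivation_mul, ih, h]
    noncomm_ring

/-- For the (unique) `𝔽_p`-linear derivation `D` of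
`R = 𝔽_p[f, g, α₁, α₂, t]` with `D f = f(2g − f − t) − α₁`, `D g = g(2f − g + t) + α₂`,
`D α₁ = D α₂ = 0` and `D t = 1` (the vector field of the fourth Painlevé equation),
one has `D I_p = 0`: the polynomial `I_p` is an integral of motion of `P_IV`. -/
theorem Ip_integral_of_motion_PIV (p : ℕ) (hp : p.Prime)
    (D : Derivation (ZMod p) (R p) (R p))
    (hf : D (fP p) = fP p * (2 * gP p - fP p - tP p) - a1P p)
    (hg : D (gP p) = gP p * (2 * fP p - gP p + tP p) + a2P p)
    (ha1 : D (a1P p) = 0) (ha2 : D (a2P p) = 0) (ht : D (tP p) = 1) :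
    D (Ip p) = 0 := by
  have key := map_derivation_prod_of_lax D (fun k : ℕ => AM p (RingHom.id (R p)) (k : R p))
    (fun k : ℕ => laxB p (k : R p))
    (fun k => by
      simpa using map_derivation_AM p D hf hg ha1 ha2 ht (k : R p) (D.map_natCast k)) p
  have htr : D (Ip p) = Matrix.trace
      ((((List.range p).reverse.map
        (fun k : ℕ => AM p (RingHom.id (R p)) (k : R p))).prod).map D) := by
    simp [Ip, Matrix.trace, Function.comp_def, ← List.map_eq_flatMap]
  rw [htr, key, Matrix.trace_sub, Matrix.trace_mul_comm]
  simp
end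

section
/- Let p be a prime. The polynomial I_p ∈ R has degree exactly 2p in the variable f, degree exactly 2p in the variable g, and its total degree with respect to the pair (f, g) (the maximum over its monomials of the sum of the exponents of f and g) is exactly 3p. Moreover, the difference I_p − (f^p·g^{2p} − f^{2p}·g^p) has degree at most 2p − 1 in f and degree at most 2p − 1 in g; that is, I_p = −f^{2p}·g^p + f^p·g^{2p} + O(f, g) where O(f, g) ∈ 𝔽_p[f, g, α₁, α₂, t] has degree less than 2p in f and degree less than 2p in g. -/
open MvPolynomial

/-- Every monomial of `P` has weight less than `n`. -/
def WeightLT {σ S : Type*} [CommRing S] (w : (σ →₀ ℕ) →+ ℕ) (n : ℕ) (P : MvPolynomial σ S) : Prop :=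
  ∀ m ∈ P.support, w m < n

namespace WeightLT

variable {σ S : Type*} [CommRing S] {w : (σ →₀ ℕ) →+ ℕ} {n k l : ℕ} {P Q : MvPolynomial σ S}

theorem mono (h : WeightLT w n P) (hn : n ≤ k) : WeightLT w k P :=
  fun m hm => (h m hm).trans_le hn

theorem add (hP : WeightLT w n P) (hQ : WeightLT w n Q) : WeightLT w n (P + Q) := by
  classical
  intro m hm
  rcases Finset.mem_union.1 (support_add hm) with h | h
  exacts [hP m h, hQ m h]

theorem neg (hP : WeightLT w n P) : WeightLT w n (-P) := by
  intro m hm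
  rw [support_neg] at hm
  exact hP m hm

theorem sub (hP : WeightLT w n P) (hQ : WeightLT w n Q) : WeightLT w n (P - Q) := by
  rw [sub_eq_add_neg]
  exact hP.add hQ.neg

theorem mul (hP : WeightLT w (k + 1) P) (hQ : WeightLT w n Q) (hl : k + n ≤ l) :
    WeightLT w l (P * Q) := by
  classical
  intro m hm
  obtain ⟨a, ha, b, hb, rfl⟩ := Finset.mem_add.1 (support_mul P Q hm)
  have h₁ := hP a ha
  have h₂ := hQ b hb
  rw [map_add]
  omega

theorem zero : WeightLT w n (0 : MvPolynomial σ S) := by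
  intro m hm
  simp at hm

theorem C (c : S) : WeightLT w 1 (C c : MvPolynomial σ S) := by
  classical
  intro m hm
  have h := support_monomial_subset hm
  rw [Finset.mem_singleton.1 h, map_zero]
  exact Nat.one_pos

theorem one : WeightLT w 1 (1 : MvPolynomial σ S) := C 1

theorem natCast (c : ℕ) : WeightLT w 1 (c : MvPolynomial σ S) := by
  simpa using C (w := w) (c : S)

theorem monomial {m : σ →₀ ℕ} (c : S) (h : w m < n) : WeightLT w n (monomial m c) := by
  classical
  intro m' hm
  rwa [Finset.mem_singleton.1 (support_monomial_subset hm)]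

theorem X {i : σ} (h : w (Finsupp.single i 1) < n) : WeightLT w n (X i : MvPolynomial σ S) :=
  monomial 1 h

theorem coeff_eq_zero (h : WeightLT w n P) {m : σ →₀ ℕ} (hm : n ≤ w m) : coeff m P = 0 := by
  by_contra hc
  exact absurd (h m (mem_support_iff.2 hc)) (not_lt.2 hm)

end WeightLT

noncomputable section

/-- The lower triangular gauge matrix removing the cubic term of the Lax matrix. -/
def gaugeMatrix (p : ℕ) (z : R p) : Matrix (Fin 2) (Fin 2) (R p) :=
  !![1, 0; -(tP p * (z + fP p * gP p)), 1]

def gaugedLax00 (p : ℕ) : R p := gP p * (fP p * gP p - a1P p)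

def gaugedLax01 (p : ℕ) (z : R p) : R p := z - fP p * gP p

def gaugedLax10 (p : ℕ) (z : R p) : R p :=
  z * z + (fP p * gP p - a1P p + a2P p) * z
    + (fP p * gP p - a1P p) * (fP p * gP p + a2P p)
    + tP p * (gP p * (fP p * gP p - a1P p))

def gaugedLax11 (p : ℕ) (z : R p) : R p :=
  tP p * (z - fP p * gP p) - fP p * (fP p * gP p + a2P p)

/-- The Lax matrix after the gauge transformation. -/
def gaugedLax (p : ℕ) (z : R p) : Matrix (Fin 2) (Fin 2) (R p) :=
  !![gaugedLax00 p, gaugedLax01 p z; gaugedLax10 p z, gaugedLax11 p z]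

/-- The product `B(n-1) ⋯ B(1) B(0)` of gauge transformed Lax matrices. -/
def gaugedProd (p : ℕ) : ℕ → Matrix (Fin 2) (Fin 2) (R p)
  | 0 => 1
  | n + 1 => gaugedLax p n * gaugedProd p n

end

theorem AM_mul_gaugeMatrix (p : ℕ) (z : R p) :
    AM p (RingHom.id (R p)) z * gaugeMatrix p z = gaugeMatrix p (z + 1) * gaugedLax p z := by
  refine Matrix.ext fun i j => ?_
  fin_cases i <;> fin_cases j <;>
    simp [AM, A0, A1, A2, A3, hP, gaugeMatrix, gaugedLax, gaugedLax00, gaugedLax01,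
      gaugedLax10, gaugedLax11, Matrix.mul_apply, Fin.sum_univ_two] <;> ring

theorem prod_AM_mul_gaugeMatrix (p n : ℕ) :
    ((List.range n).reverse.map (fun k : ℕ => AM p (RingHom.id (R p)) (k : R p))).prod
      * gaugeMatrix p 0 = gaugeMatrix p n * gaugedProd p n := by
  induction n with
  | zero => simp [gaugedProd]
  | succ n ih =>
    simp only [List.range_succ, List.reverse_append, List.reverse_cons, List.reverse_nil,
      List.nil_append, List.singleton_append, List.map_cons, List.prod_cons, gaugedProd]
    rw [Matrix.mul_assoc, ih, ← Matrix.mul_assoc, AM_mul_gaugeMatrix, Matrix.mul_assoc,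
      Nat.cast_succ]

theorem Ip_eq_trace_prod (p : ℕ) :
    Ip p = Matrix.trace
      ((List.range p).reverse.map (fun k : ℕ => AM p (RingHom.id (R p)) (k : R p))).prod := by
  simp only [Ip, List.bind_eq_flatMap, List.pure_def, ← List.map_eq_flatMap, List.map_map,
    Function.comp_def]

theorem Ip_eq_trace_gaugedProd (p : ℕ) : Ip p = gaugedProd p p 0 0 + gaugedProd p p 1 1 := by
  have h := prod_AM_mul_gaugeMatrix p p
  have hdet : IsUnit (gaugeMatrix p 0).det := by simp [gaugeMatrix, Matrix.det_fin_two]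
  rw [CharP.cast_eq_zero (R p) p] at h
  rw [← Matrix.trace_fin_two, Ip_eq_trace_prod, ← Matrix.mul_nonsing_inv_cancel_right _ (List.prod _) hdet, h,
    Matrix.trace_mul_comm, Matrix.nonsing_inv_mul_cancel_left _ _ hdet]

theorem gaugedProd_succ_zero (p n : ℕ) (j : Fin 2) :
    gaugedProd p (n + 1) 0 j
      = gaugedLax00 p * gaugedProd p n 0 j + gaugedLax01 p n * gaugedProd p n 1 j := by
  simp [gaugedProd, gaugedLax, Matrix.mul_apply, Fin.sum_univ_two]

theorem gaugedProd_succ_one (p n : ℕ) (j : Fin 2) :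
    gaugedProd p (n + 1) 1 j
      = gaugedLax10 p n * gaugedProd p n 0 j + gaugedLax11 p n * gaugedProd p n 1 j := by
  simp [gaugedProd, gaugedLax, Matrix.mul_apply, Fin.sum_univ_two]

/-- The exponent of the `i`-th variable. -/
def expWeight (i : Fin 5) : (Fin 5 →₀ ℕ) →+ ℕ := Finsupp.applyAddHom i

theorem expWeight_apply (i : Fin 5) (m : Fin 5 →₀ ℕ) : expWeight i m = m i := rfl

section Entries

variable {p : ℕ} {w : (Fin 5 →₀ ℕ) →+ ℕ} {a b : ℕ}

/-- The weight `w` gives `f` weight `a`, `g` weight `b` and the parameters weight `0`. -/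
structure IsFGWeight (w : (Fin 5 →₀ ℕ) →+ ℕ) (a b : ℕ) : Prop where
  f : w (Finsupp.single 0 1) = a
  g : w (Finsupp.single 1 1) = b
  a1 : w (Finsupp.single 2 1) = 0
  a2 : w (Finsupp.single 3 1) = 0
  t : w (Finsupp.single 4 1) = 0

namespace IsFGWeight

theorem fP (h : IsFGWeight w a b) : WeightLT w (a + 1) (fP p) := .X (by have := h.f; omega)
theorem gP (h : IsFGWeight w a b) : WeightLT w (b + 1) (gP p) := .X (by have := h.g; omega)
theorem a1P (h : IsFGWeight w a b) : WeightLT w 1 (a1P p) := .X (by have := h.a1; omega)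
theorem a2P (h : IsFGWeight w a b) : WeightLT w 1 (a2P p) := .X (by have := h.a2; omega)
theorem tP (h : IsFGWeight w a b) : WeightLT w 1 (tP p) := .X (by have := h.t; omega)

theorem fg (h : IsFGWeight w a b) : WeightLT w (a + b + 1) (_root_.fP p * _root_.gP p) :=
  h.fP.mul h.gP (by omega)

theorem fg_sub_a1 (h : IsFGWeight w a b) :
    WeightLT w (a + b + 1) (_root_.fP p * _root_.gP p - _root_.a1P p) :=
  h.fg.sub (h.a1P.mono (by omega))

theorem fg_add_a2 (h : IsFGWeight w a b) :
    WeightLT w (a + b + 1) (_root_.fP p * _root_.gP p + _root_.a2P p) :=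
  h.fg.add (h.a2P.mono (by omega))

theorem gaugedLax00 (h : IsFGWeight w a b) : WeightLT w (a + 2 * b + 1) (gaugedLax00 p) :=
  h.gP.mul h.fg_sub_a1 (by omega)

theorem gaugedLax01 (h : IsFGWeight w a b) (n : ℕ) :
    WeightLT w (a + b + 1) (gaugedLax01 p n) :=
  ((WeightLT.natCast n).mono (by omega)).sub h.fg

theorem gaugedLax10 (h : IsFGWeight w a b) (n : ℕ) :
    WeightLT w (2 * a + 2 * b + 1) (gaugedLax10 p n) := by
  refine .add (.add (.add ?_ ?_) ?_) ?_
  · exact (WeightLT.natCast n).mul (WeightLT.natCast n) (by omega)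
  · exact (h.fg_sub_a1.add (h.a2P.mono (by omega))).mul (WeightLT.natCast n) (by omega)
  · exact h.fg_sub_a1.mul h.fg_add_a2 (by omega)
  · exact h.tP.mul h.gaugedLax00 (by omega)

theorem gaugedLax11 (h : IsFGWeight w a b) (n : ℕ) :
    WeightLT w (2 * a + b + 1) (gaugedLax11 p n) :=
  (h.tP.mul (h.gaugedLax01 n) (by omega)).sub (h.fP.mul h.fg_add_a2 (by omega))

end IsFGWeight

end Entries

theorem isFGWeight_f : IsFGWeight (expWeight 0) 1 0 := by
  constructor <;> simp [expWeight]

theorem isFGWeight_g : IsFGWeight (expWeight 1) 0 1 := by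
  constructor <;> simp [expWeight]

theorem isFGWeight_fg : IsFGWeight (expWeight 0 + expWeight 1) 1 1 := by
  constructor <;> simp [expWeight]

/-- Degrees in `f` of the first column. -/
theorem weightLT_f_col_zero (p n : ℕ) :
    WeightLT (expWeight 0) (2 * n + 1) (gaugedProd p n 0 0) ∧
    WeightLT (expWeight 0) (2 * n + 1) (gaugedProd p n 1 0) := by
  have H := isFGWeight_f
  induction n with
  | zero => exact ⟨by simpa [gaugedProd] using .one, by simpa [gaugedProd] using .zero⟩
  | succ n ih =>
    rw [gaugedProd_succ_zero, gaugedProd_succ_one]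
    exact ⟨(H.gaugedLax00.mul ih.1 (by omega)).add ((H.gaugedLax01 n).mul ih.2 (by omega)),
      ((H.gaugedLax10 n).mul ih.1 (by omega)).add ((H.gaugedLax11 n).mul ih.2 (by omega))⟩

theorem weightLT_f_zero_zero (p n : ℕ) (hn : n ≠ 0) :
    WeightLT (expWeight 0) (2 * n) (gaugedProd p n 0 0) := by
  have H := isFGWeight_f
  obtain ⟨n, rfl⟩ := Nat.exists_eq_succ_of_ne_zero hn
  have ih := weightLT_f_col_zero p n
  rw [gaugedProd_succ_zero]
  exact (H.gaugedLax00.mul ih.1 (by omega)).add ((H.gaugedLax01 n).mul ih.2 (by omega))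

/-- Leading term in `f` of the second column. -/
theorem weightLT_f_col_one (p n : ℕ) :
    WeightLT (expWeight 0) (2 * n) (gaugedProd p n 0 1) ∧
    WeightLT (expWeight 0) (2 * n) (gaugedProd p n 1 1 - (-gP p * fP p ^ 2) ^ n) := by
  have H := isFGWeight_f
  have hmon : WeightLT (expWeight 0) (2 + 1) (-gP p * fP p ^ 2) := by
    rw [pow_two]
    exact H.gP.neg.mul (H.fP.mul H.fP le_rfl) le_rfl
  induction n with
  | zero => exact ⟨by simpa [gaugedProd] using .zero, by simpa [gaugedProd] using .zero⟩
  | succ n ih =>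
    have hlead : WeightLT (expWeight 0) (2 * n + 1) ((-gP p * fP p ^ 2) ^ n) := by
      clear ih
      induction n with
      | zero => simpa using .one
      | succ n ih =>
        rw [pow_succ']
        exact hmon.mul ih (by omega)
    have h11 : WeightLT (expWeight 0) (2 * n + 1) (gaugedProd p n 1 1) := by
      simpa using (ih.2.mono (Nat.le_succ _)).add hlead
    rw [gaugedProd_succ_zero, gaugedProd_succ_one]
    refine ⟨(H.gaugedLax00.mul ih.1 (by omega)).add ((H.gaugedLax01 n).mul h11 (by omega)), ?_⟩
    have hsplit : gaugedLax10 p n * gaugedProd p n 0 1 + gaugedLax11 p n * gaugedProd p n 1 1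
          - (-gP p * fP p ^ 2) ^ (n + 1)
        = gaugedLax10 p n * gaugedProd p n 0 1
          + (tP p * gaugedLax01 p n - fP p * a2P p) * gaugedProd p n 1 1
          + (-gP p * fP p ^ 2) * (gaugedProd p n 1 1 - (-gP p * fP p ^ 2) ^ n) := by
      rw [gaugedLax11, gaugedLax01]
      ring
    rw [hsplit]
    refine .add (.add ((H.gaugedLax10 n).mul ih.1 (by omega)) ?_) ?_
    · have hlow : WeightLT (expWeight 0) (1 + 1) (tP p * gaugedLax01 p n - fP p * a2P p) :=
        (H.tP.mul (H.gaugedLax01 n) le_rfl).sub (H.fP.mul H.a2P le_rfl)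
      exact hlow.mul h11 (by omega)
    · exact hmon.mul ih.2 (by omega)

/-- Leading term in `g` of the first column. -/
theorem weightLT_g_col_zero (p n : ℕ) :
    WeightLT (expWeight 1) (2 * n) (gaugedProd p n 0 0 - (fP p * gP p ^ 2) ^ n) ∧
    WeightLT (expWeight 1) (2 * n + 1) (gaugedProd p n 1 0) := by
  have H := isFGWeight_g
  have hmon : WeightLT (expWeight 1) (2 + 1) (fP p * gP p ^ 2) := by
    rw [pow_two]
    exact H.fP.mul (H.gP.mul H.gP le_rfl) le_rfl
  induction n with
  | zero => exact ⟨by simpa [gaugedProd] using .zero, by simpa [gaugedProd] using .zero⟩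
  | succ n ih =>
    have hlead : WeightLT (expWeight 1) (2 * n + 1) ((fP p * gP p ^ 2) ^ n) := by
      clear ih
      induction n with
      | zero => simpa using .one
      | succ n ih =>
        rw [pow_succ']
        exact hmon.mul ih (by omega)
    have h00 : WeightLT (expWeight 1) (2 * n + 1) (gaugedProd p n 0 0) := by
      simpa using (ih.1.mono (Nat.le_succ _)).add hlead
    rw [gaugedProd_succ_zero, gaugedProd_succ_one]
    refine ⟨?_, ((H.gaugedLax10 n).mul h00 (by omega)).add
      ((H.gaugedLax11 n).mul ih.2 (by omega))⟩
    have hsplit : gaugedLax00 p * gaugedProd p n 0 0 + gaugedLax01 p n * gaugedProd p n 1 0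
          - (fP p * gP p ^ 2) ^ (n + 1)
        = gaugedLax01 p n * gaugedProd p n 1 0 - (gP p * a1P p) * gaugedProd p n 0 0
          + (fP p * gP p ^ 2) * (gaugedProd p n 0 0 - (fP p * gP p ^ 2) ^ n) := by
      rw [gaugedLax00]
      ring
    rw [hsplit]
    refine .add (.sub ((H.gaugedLax01 n).mul ih.2 (by omega)) ?_) ?_
    · exact (H.gP.mul H.a1P le_rfl).mul h00 (by omega)
    · exact hmon.mul ih.1 (by omega)

/-- Degrees in `g` of the second column. -/
theorem weightLT_g_col_one (p n : ℕ) :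
    WeightLT (expWeight 1) (2 * n) (gaugedProd p n 0 1) ∧
    WeightLT (expWeight 1) (2 * n + 1) (gaugedProd p n 1 1) := by
  have H := isFGWeight_g
  induction n with
  | zero => exact ⟨by simpa [gaugedProd] using .zero, by simpa [gaugedProd] using .one⟩
  | succ n ih =>
    rw [gaugedProd_succ_zero, gaugedProd_succ_one]
    exact ⟨(H.gaugedLax00.mul ih.1 (by omega)).add ((H.gaugedLax01 n).mul ih.2 (by omega)),
      ((H.gaugedLax10 n).mul ih.1 (by omega)).add ((H.gaugedLax11 n).mul ih.2 (by omega))⟩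

theorem weightLT_g_one_one (p n : ℕ) (hn : n ≠ 0) :
    WeightLT (expWeight 1) (2 * n) (gaugedProd p n 1 1) := by
  have H := isFGWeight_g
  obtain ⟨n, rfl⟩ := Nat.exists_eq_succ_of_ne_zero hn
  have ih := weightLT_g_col_one p n
  rw [gaugedProd_succ_one]
  exact ((H.gaugedLax10 n).mul ih.1 (by omega)).add ((H.gaugedLax11 n).mul ih.2 (by omega))

/-- Total degrees in `(f, g)` of the entries. -/
theorem weightLT_fg_gaugedProd (p n : ℕ) :
    WeightLT (expWeight 0 + expWeight 1) (3 * n + 1) (gaugedProd p n 0 0) ∧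
    WeightLT (expWeight 0 + expWeight 1) (3 * n + 2) (gaugedProd p n 1 0) ∧
    WeightLT (expWeight 0 + expWeight 1) (3 * n) (gaugedProd p n 0 1) ∧
    WeightLT (expWeight 0 + expWeight 1) (3 * n + 1) (gaugedProd p n 1 1) := by
  have H := isFGWeight_fg
  induction n with
  | zero =>
    exact ⟨by simpa [gaugedProd] using .one, by simpa [gaugedProd] using .zero,
      by simpa [gaugedProd] using .zero, by simpa [gaugedProd] using .one⟩
  | succ n ih =>
    obtain ⟨h00, h10, h01, h11⟩ := ih
    simp only [gaugedProd_succ_zero, gaugedProd_succ_one]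
    exact ⟨(H.gaugedLax00.mul h00 (by omega)).add ((H.gaugedLax01 n).mul h10 (by omega)),
      ((H.gaugedLax10 n).mul h00 (by omega)).add ((H.gaugedLax11 n).mul h10 (by omega)),
      (H.gaugedLax00.mul h01 (by omega)).add ((H.gaugedLax01 n).mul h11 (by omega)),
      ((H.gaugedLax10 n).mul h01 (by omega)).add ((H.gaugedLax11 n).mul h11 (by omega))⟩

theorem fP_pow_mul_gP_pow (p i j : ℕ) :
    fP p ^ i * gP p ^ j = monomial (Finsupp.single 0 i + Finsupp.single 1 j) 1 := by
  rw [fP, gP, X_pow_eq_monomial, X_pow_eq_monomial, monomial_mul, one_mul]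

theorem weightLT_f_Ip_sub (p : ℕ) (hp : p.Prime) :
    WeightLT (expWeight 0) (2 * p)
      (Ip p - (fP p ^ p * gP p ^ (2 * p) - fP p ^ (2 * p) * gP p ^ p)) := by
  have := Fact.mk hp
  have hpos := hp.pos
  have hmon : WeightLT (expWeight 0) (2 * p) (fP p ^ p * gP p ^ (2 * p)) := by
    rw [fP_pow_mul_gP_pow]
    refine .monomial _ ?_
    simp [expWeight_apply]
    omega
  have hlead : (-gP p * fP p ^ 2) ^ p = -(fP p ^ (2 * p) * gP p ^ p) := by
    rw [neg_mul, neg_pow, neg_one_pow_char, mul_pow, ← pow_mul]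
    ring
  have h := (weightLT_f_zero_zero p p hp.ne_zero).add (weightLT_f_col_one p p).2
  rw [hlead] at h
  convert h.sub hmon using 1
  rw [Ip_eq_trace_gaugedProd]
  ring

theorem weightLT_g_Ip_sub (p : ℕ) (hp : p.Prime) :
    WeightLT (expWeight 1) (2 * p)
      (Ip p - (fP p ^ p * gP p ^ (2 * p) - fP p ^ (2 * p) * gP p ^ p)) := by
  have hpos := hp.pos
  have hmon : WeightLT (expWeight 1) (2 * p) (fP p ^ (2 * p) * gP p ^ p) := by
    rw [fP_pow_mul_gP_pow]
    refine .monomial _ ?_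
    simp [expWeight_apply]
    omega
  have h := (weightLT_g_one_one p p hp.ne_zero).add (weightLT_g_col_zero p p).1
  convert h.add hmon using 1
  rw [Ip_eq_trace_gaugedProd, mul_pow, ← pow_mul]
  ring

/-- `I_p` has degree exactly `2p` in `f` (variable `0`), degree exactly
`2p` in `g` (variable `1`), total degree `3p` with respect to the pair `(f, g)`, and
`I_p = −f^{2p}·g^p + f^p·g^{2p} + O(f,g)` with `O(f,g)` of degree `< 2p` in `f` and `< 2p`
in `g`. -/
theorem Ip_degrees (p : ℕ) (hp : p.Prime) :
    degreeOf 0 (Ip p) = 2 * p ∧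
    degreeOf 1 (Ip p) = 2 * p ∧
    (Ip p).support.sup (fun m => m 0 + m 1) = 3 * p ∧
    degreeOf 0 (Ip p - (fP p ^ p * gP p ^ (2 * p) - fP p ^ (2 * p) * gP p ^ p)) ≤ 2 * p - 1 ∧
    degreeOf 1 (Ip p - (fP p ^ p * gP p ^ (2 * p) - fP p ^ (2 * p) * gP p ^ p)) ≤ 2 * p - 1 := by
  have := Fact.mk hp
  have hpos := hp.pos
  have hf := weightLT_f_Ip_sub p hp
  have hg := weightLT_g_Ip_sub p hp
  have hne : (Finsupp.single 0 p + Finsupp.single 1 (2 * p) : Fin 5 →₀ ℕ)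
      ≠ Finsupp.single 0 (2 * p) + Finsupp.single 1 p := by
    intro h
    have := DFunLike.congr_fun h 0
    simp at this
    omega
  have hfmem : (Finsupp.single 0 (2 * p) + Finsupp.single 1 p : Fin 5 →₀ ℕ) ∈ (Ip p).support := by
    have h := hf.coeff_eq_zero (m := Finsupp.single 0 (2 * p) + Finsupp.single 1 p)
      (by simp [expWeight_apply])
    rw [fP_pow_mul_gP_pow, fP_pow_mul_gP_pow, coeff_sub, coeff_sub, coeff_monomial,
      coeff_monomial, if_neg hne, if_pos rfl, sub_eq_zero] at h
    rw [mem_support_iff, h]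
    simp
  have hgmem : (Finsupp.single 0 p + Finsupp.single 1 (2 * p) : Fin 5 →₀ ℕ) ∈ (Ip p).support := by
    have h := hg.coeff_eq_zero (m := Finsupp.single 0 p + Finsupp.single 1 (2 * p))
      (by simp [expWeight_apply])
    rw [fP_pow_mul_gP_pow, fP_pow_mul_gP_pow, coeff_sub, coeff_sub, coeff_monomial,
      coeff_monomial, if_neg hne.symm, if_pos rfl, sub_eq_zero] at h
    rw [mem_support_iff, h]
    simp
  have hI := Ip_eq_trace_gaugedProd p
  have hlead : WeightLT (expWeight 0) (2 * p + 1)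
        (fP p ^ p * gP p ^ (2 * p) - fP p ^ (2 * p) * gP p ^ p) ∧
      WeightLT (expWeight 1) (2 * p + 1)
        (fP p ^ p * gP p ^ (2 * p) - fP p ^ (2 * p) * gP p ^ p) := by
    rw [fP_pow_mul_gP_pow, fP_pow_mul_gP_pow]
    constructor <;> refine .sub (.monomial _ ?_) (.monomial _ ?_) <;>
      simp [expWeight_apply] <;> omega
  have hIf : WeightLT (expWeight 0) (2 * p + 1) (Ip p) := by
    simpa using (hf.mono (Nat.le_succ _)).add hlead.1
  have hIg : WeightLT (expWeight 1) (2 * p + 1) (Ip p) := by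
    simpa using (hg.mono (Nat.le_succ _)).add hlead.2
  have hIfg : WeightLT (expWeight 0 + expWeight 1) (3 * p + 1) (Ip p) := by
    obtain ⟨h00, -, -, h11⟩ := weightLT_fg_gaugedProd p p
    rw [hI]
    exact h00.add h11
  refine ⟨le_antisymm ?_ ?_, le_antisymm ?_ ?_, le_antisymm ?_ ?_, ?_, ?_⟩
  · exact degreeOf_le_iff.2 fun m hm => Nat.lt_succ_iff.1 (hIf m hm)
  · simpa using degreeOf_le_iff.1 (le_refl (degreeOf 0 (Ip p))) _ hfmem
  · exact degreeOf_le_iff.2 fun m hm => Nat.lt_succ_iff.1 (hIg m hm)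
  · simpa using degreeOf_le_iff.1 (le_refl (degreeOf 1 (Ip p))) _ hgmem
  · exact Finset.sup_le fun m hm => Nat.lt_succ_iff.1 (hIfg m hm)
  · refine le_trans ?_ (Finset.le_sup (f := fun m : Fin 5 →₀ ℕ => m 0 + m 1) hgmem)
    simp
    omega
  · exact degreeOf_le_iff.2 fun m hm => Nat.le_sub_one_of_lt (hf m hm)
  · exact degreeOf_le_iff.2 fun m hm => Nat.le_sub_one_of_lt (hg m hm)
end

section
/- Let p ≥ 5 be a prime and define the normalised integral Ĩ_p = I_p + 3⁻¹·t^p·(α₁^p − α₁ − α₂^p + α₂) ∈ R, where 3⁻¹ denotes the inverse of 3 in 𝔽_p. Then Ĩ_p is completely invariant under the extended affine Weyl group action: for every field K of characteristic p and a, b, c, d, e ∈ K, (i) if a − b + e ≠ 0 then, with r = (c + d − 1)/(a − b + e), Ĩ_p(a + r, b + r, 1 − d, 1 − c, e) = Ĩ_p(a, b, c, d, e) (generator s₀); (ii) if a ≠ 0 then Ĩ_p(a, b − c/a, −c, d + c, e) = Ĩ_p(a, b, c, d, e) (generator s₁); (iii) if b ≠ 0 then Ĩ_p(a + d/b, b,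 c + d, −d, e) = Ĩ_p(a, b, c, d, e) (generator s₂); (iv) Ĩ_p(−b, a − b + e, d, 1 − c − d, e) = Ĩ_p(a, b, c, d, e) (generator π). Here Ĩ_p(·) denotes evaluation of Ĩ_p at (f, g, α₁, α₂, t) equal to the indicated tuple. -/
open MvPolynomial

/-- The normalised integral `Ĩ_p = I_p + 3⁻¹·t^p·(α₁^p − α₁ − α₂^p + α₂)`, for `p ≥ 5`. -/
noncomputable def Itil (p : ℕ) : R p :=
  Ip p + C ((3 : ZMod p)⁻¹) * tP p ^ p * (a1P p ^ p - a1P p - a2P p ^ p + a2P p)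


/-- The ordered product `B (n - 1) * ⋯ * B 1 * B 0`. -/
def descProd {M : Type*} [Monoid M] (B : ℕ → M) : ℕ → M
  | 0 => 1
  | n + 1 => B n * descProd B n

section DescProd

variable {M N : Type*} [Monoid M] [Monoid N]

theorem list_prod_reverse_range (B : ℕ → M) (n : ℕ) :
    ((List.range n).reverse.map B).prod = descProd B n := by
  induction n with
  | zero => rfl
  | succ n ih => simp [List.range_succ, descProd, ← ih]

theorem descProd_add (B : ℕ → M) (m n : ℕ) :
    descProd B (m + n) = descProd (fun k => B (m + k)) n * descProd B m := by
  induction n with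
  | zero => simp [descProd]
  | succ n ih => rw [← add_assoc, descProd, descProd, ih, mul_assoc]

theorem map_descProd {F : Type*} [FunLike F M N] [MonoidHomClass F M N] (φ : F) (B : ℕ → M)
    (n : ℕ) : φ (descProd B n) = descProd (fun k => φ (B k)) n := by
  induction n with
  | zero => simp [descProd]
  | succ n ih => simp [descProd, ih]

theorem descProd_gauge {A B Q : ℕ → M} (h : ∀ k, Q (k + 1) * A k = B k * Q k) (n : ℕ) :
    Q n * descProd A n = descProd B n * Q 0 := by
  induction n with
  | zero => simp [descProd]
  | succ n ih => rw [descProd, descProd, ← mul_assoc, h, mul_assoc, ih, mul_assoc]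

theorem descProd_succ_mul (A B : ℕ → M) (n : ℕ) :
    descProd (fun k => A k * B k) (n + 1) =
      A n * descProd (fun k => B (k + 1) * A k) n * B 0 := by
  induction n with
  | zero => simp [descProd]
  | succ n ih => rw [descProd, ih]; simp only [descProd, mul_assoc]

theorem descProd_mul_descProd_of_periodic {B : ℕ → M} {p : ℕ} (hB : ∀ k, B (p + k) = B k)
    {k : ℕ} (hk : k < p) :
    descProd B k * descProd (fun j => B (k + 1 + j)) (p - 1 - k) =
      descProd (fun j => B (k + 1 + j)) (p - 1) := by
  have h := descProd_add (fun j => B (k + 1 + j)) (p - 1 - k) k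
  rw [show p - 1 - k + k = p - 1 by omega] at h
  rw [h]
  congr 2
  funext j
  rw [← hB j]
  congr 1
  omega

end DescProd

theorem map_derivative_mul {S : Type*} [CommRing S] {ι : Type*} [Fintype ι]
    (A B : Matrix ι ι (Polynomial S)) :
    (A * B).map Polynomial.derivative =
      A.map Polynomial.derivative * B + A * B.map Polynomial.derivative := by
  ext1 i j
  simp [Matrix.mul_apply, Polynomial.derivative_mul, Finset.sum_add_distrib]

section TraceDescProd

variable {S : Type*} [CommRing S] {ι : Type*} [Fintype ι] [DecidableEq ι]

theorem trace_descProd_gauge {A B Q : ℕ → Matrix ι ι S}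
    (h : ∀ k, Q (k + 1) * A k = B k * Q k) {p : ℕ} (hQ : Q p = Q 0) {V : Matrix ι ι S}
    (hV : V * Q 0 = 1) : (descProd A p).trace = (descProd B p).trace := by
  have h1 := descProd_gauge h p
  rw [hQ] at h1
  rw [← one_mul (descProd A p), ← hV, mul_assoc, h1, Matrix.trace_mul_comm, mul_assoc,
    mul_eq_one_comm.mp hV, mul_one]

theorem trace_descProd_rotate (A B : ℕ → Matrix ι ι S) {p : ℕ} (hp : p ≠ 0) (hB : B p = B 0) :
    (descProd (fun k => A k * B k) p).trace =
      (descProd (fun k => B (k + 1) * A k) p).trace := by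
  obtain ⟨n, rfl⟩ := Nat.exists_eq_succ_of_ne_zero hp
  rw [Nat.succ_eq_add_one] at hB ⊢
  rw [descProd_succ_mul, Matrix.trace_mul_comm, ← mul_assoc, ← hB, descProd]

theorem map_derivative_descProd (B : ℕ → Matrix ι ι (Polynomial S)) (n : ℕ) :
    (descProd B n).map Polynomial.derivative =
      ∑ k ∈ Finset.range n, descProd (fun j => B (k + 1 + j)) (n - 1 - k) *
        (B k).map Polynomial.derivative * descProd B k := by
  induction n with
  | zero => ext1 i j; by_cases h : i = j <;> simp [descProd, h]
  | succ n ih =>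
    have h : ∀ k ∈ Finset.range n,
        descProd (fun j => B (k + 1 + j)) (n + 1 - 1 - k) *
          (B k).map Polynomial.derivative * descProd B k =
        B n * (descProd (fun j => B (k + 1 + j)) (n - 1 - k) *
          (B k).map Polynomial.derivative * descProd B k) := by
      intro k hk
      have hk := Finset.mem_range.mp hk
      rw [show n + 1 - 1 - k = n - 1 - k + 1 by omega, descProd,
        show k + 1 + (n - 1 - k) = n by omega, mul_assoc, mul_assoc, mul_assoc]
    rw [descProd, map_derivative_mul, ih, Finset.sum_range_succ, Finset.sum_congr rfl h,
      ← Finset.mul_sum, Nat.add_sub_cancel, Nat.sub_self]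
    simp only [descProd, one_mul]
    exact add_comm _ _

theorem derivative_trace_descProd {B : ℕ → Matrix ι ι (Polynomial S)} {p : ℕ}
    (hB : ∀ k, B (p + k) = B k) :
    Polynomial.derivative (descProd B p).trace =
      ∑ k ∈ Finset.range p, ((B k).map Polynomial.derivative *
        descProd (fun j => B (k + 1 + j)) (p - 1)).trace := by
  have h : Polynomial.derivative (descProd B p).trace =
      ((descProd B p).map Polynomial.derivative).trace := by simp [Matrix.trace]
  rw [h, map_derivative_descProd, Matrix.trace_sum]
  refine Finset.sum_congr rfl fun k hk => ?_
  rw [mul_assoc, Matrix.trace_mul_comm, mul_assoc,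
    descProd_mul_descProd_of_periodic hB (Finset.mem_range.mp hk)]

theorem map_trace_descProd {S' : Type*} [CommRing S'] (φ : S →+* S')
    (B : ℕ → Matrix ι ι S) (n : ℕ) :
    φ (descProd B n).trace = (descProd (fun k => φ.mapMatrix (B k)) n).trace := by
  rw [← map_descProd]
  simp [Matrix.trace]

end TraceDescProd

section Filtration

variable {S : Type*} [CommRing S]

/-- Polynomials of degree at most `i / 2`. -/
def halfDegreeLE (S : Type*) [CommRing S] (i : ℤ) : AddSubmonoid (Polynomial S) where
  carrier := {P | ∀ j : ℕ, i < 2 * j → P.coeff j = 0}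
  zero_mem' := by simp
  add_mem' := fun hP hQ j hj => by simp [hP j hj, hQ j hj]

theorem mem_halfDegreeLE_of_natDegree_le {P : Polynomial S} {i : ℤ} {n : ℕ}
    (h : P.natDegree ≤ n) (hi : 2 * (n : ℤ) ≤ i) : P ∈ halfDegreeLE S i := fun j hj =>
  Polynomial.coeff_eq_zero_of_natDegree_lt (by omega)

theorem natDegree_lt_of_mem_halfDegreeLE {P : Polynomial S} {i : ℤ} {n : ℕ} (hn : 0 < n)
    (h : P ∈ halfDegreeLE S i) (hi : i < 2 * n) : P.natDegree < n := by
  by_contra! hlt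
  have hP : P ≠ 0 := by rintro rfl; simp at hlt; omega
  exact hP (Polynomial.leadingCoeff_eq_zero.mp (h P.natDegree (by omega)))

theorem mul_mem_halfDegreeLE {i j : ℤ} {P Q : Polynomial S} (hP : P ∈ halfDegreeLE S i)
    (hQ : Q ∈ halfDegreeLE S j) : P * Q ∈ halfDegreeLE S (i + j) := by
  intro n hn
  rw [Polynomial.coeff_mul]
  refine Finset.sum_eq_zero fun x hx => ?_
  have hx := Finset.HasAntidiagonal.mem_antidiagonal.mp hx
  by_cases h : i < 2 * (x.1 : ℤ)
  · rw [hP _ h, zero_mul]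
  · rw [hQ _ (by omega), mul_zero]

/-- Polynomials all of whose coefficients lie in `F`. -/
def coeffFiltration (F : AddSubmonoid S) : AddSubmonoid (Polynomial S) where
  carrier := {P | ∀ j : ℕ, P.coeff j ∈ F}
  zero_mem' := by simp
  add_mem' := fun hP hQ j => by simpa using F.add_mem (hP j) (hQ j)

theorem mul_mem_coeffFiltration {F G H : AddSubmonoid S} (h : ∀ x ∈ F, ∀ y ∈ G, x * y ∈ H)
    {P Q : Polynomial S} (hP : P ∈ coeffFiltration F) (hQ : Q ∈ coeffFiltration G) :
    P * Q ∈ coeffFiltration H := by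
  intro n
  rw [Polynomial.coeff_mul]
  exact H.sum_mem fun x _ => h _ (hP _) _ (hQ _)

theorem C_mem_coeffFiltration {F : AddSubmonoid S} {x : S} (hx : x ∈ F) :
    Polynomial.C x ∈ coeffFiltration F := by
  intro j
  rw [Polynomial.coeff_C]
  split_ifs
  exacts [hx, F.zero_mem]

theorem X_mul_C_mem_coeffFiltration {F : AddSubmonoid S} {x : S} (hx : x ∈ F) :
    Polynomial.X * Polynomial.C x ∈ coeffFiltration F := by
  rintro (_ | j)
  · simp
  · rw [Polynomial.coeff_X_mul]; exact C_mem_coeffFiltration hx j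

/-- The weighted filtration of `2 × 2` matrices in which the off-diagonal entries have
weights `1` and `-1`. -/
def IsWeighted (F : ℤ → AddSubmonoid S) (i : ℤ) (A : Matrix (Fin 2) (Fin 2) S) : Prop :=
  A 0 0 ∈ F i ∧ A 0 1 ∈ F (i + 1) ∧ A 1 0 ∈ F (i - 1) ∧ A 1 1 ∈ F i

variable {F : ℤ → AddSubmonoid S}

theorem IsWeighted.mul (hF : ∀ i j, ∀ x ∈ F i, ∀ y ∈ F j, x * y ∈ F (i + j))
    {A B : Matrix (Fin 2) (Fin 2) S} {i j : ℤ} (hA : IsWeighted F i A)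
    (hB : IsWeighted F j B) : IsWeighted F (i + j) (A * B) := by
  obtain ⟨a, b, c, d⟩ := hA
  obtain ⟨a', b', c', d'⟩ := hB
  have key : ∀ {m n k : ℤ} {x y : S}, x ∈ F m → y ∈ F n → m + n = k → x * y ∈ F k :=
    fun hx hy h => h ▸ hF _ _ _ hx _ hy
  refine ⟨?_, ?_, ?_, ?_⟩ <;> rw [Matrix.mul_apply, Fin.sum_univ_two] <;>
    refine add_mem ?_ ?_
  · exact key a a' (by ring)
  · exact key b c' (by ring)
  · exact key a b' (by ring)
  · exact key b d' (by ring)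
  · exact key c a' (by ring)
  · exact key d c' (by ring)
  · exact key c b' (by ring)
  · exact key d d' (by ring)

theorem IsWeighted.trace_mem {A : Matrix (Fin 2) (Fin 2) S} {i : ℤ} (hA : IsWeighted F i A) :
    A.trace ∈ F i := by
  rw [Matrix.trace_fin_two]
  exact add_mem hA.1 hA.2.2.2

theorem IsWeighted.descProd (hF : ∀ i j, ∀ x ∈ F i, ∀ y ∈ F j, x * y ∈ F (i + j))
    (h1 : (1 : S) ∈ F 0) {B : ℕ → Matrix (Fin 2) (Fin 2) S} {i : ℤ}
    (hB : ∀ k, IsWeighted F i (B k)) (n : ℕ) : IsWeighted F (n * i) (descProd B n) := by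
  induction n with
  | zero => simpa [IsWeighted, _root_.descProd] using h1
  | succ n ih =>
    have := (hB n).mul hF ih
    rwa [show i + n * i = (n + 1 : ℕ) * i by push_cast; ring] at this

end Filtration

section ShiftInvariant

theorem eq_C_of_taylor_one_eq {p : ℕ} {K : Type*} [Field K] [CharP K p] {Q : Polynomial K}
    (hQ : Polynomial.taylor 1 Q = Q)
    (hdeg : Q.natDegree < p) : Q = Polynomial.C (Q.eval 0) := by
  have hn : ∀ n : ℕ, Q.eval (n : K) = Q.eval 0 := by
    intro n
    induction n with
    | zero => simp
    | succ n ih => rw [← ih, Nat.cast_succ, ← Polynomial.taylor_eval, hQ]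
  refine sub_eq_zero.mp (Polynomial.eq_zero_of_natDegree_lt_card_of_eval_eq_zero _
    (f := fun i : Fin p => ((i : ℕ) : K))
    (fun i j h => Fin.ext (CharP.natCast_injOn_Iio K p i.2 j.2 h)) (fun i => ?_) ?_)
  · simp [hn]
  · simpa using hdeg

variable {p : ℕ} [Fact p.Prime] {K : Type*} [Field K] [CharP K p]

theorem taylor_one_X_pow_sub_X :
    Polynomial.taylor (1 : K) (Polynomial.X ^ p - Polynomial.X) =
      Polynomial.X ^ p - Polynomial.X := by
  rw [map_sub, Polynomial.taylor_pow, Polynomial.taylor_X, add_pow_char, ← map_pow, one_pow]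
  ring

theorem eval_eq_of_taylor_one_eq {T : Polynomial K} (hT : Polynomial.taylor 1 T = T)
    (hdeg : T.natDegree < 2 * p) (x : K) :
    T.eval x = T.eval 0 + T.coeff p * (x ^ p - x) := by
  have hp1 : 1 < p := (Fact.out : p.Prime).one_lt
  set Z : Polynomial K := Polynomial.X ^ p - Polynomial.X with hZ
  have hZdeg : Z.natDegree = p := FiniteField.X_pow_card_sub_X_natDegree_eq K hp1
  have hZm : Z.Monic := Polynomial.monic_X_pow_sub (by simpa using hp1)
  have hZt : Polynomial.taylor 1 Z = Z := taylor_one_X_pow_sub_X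
  have hmod : (T %ₘ Z).degree < Z.degree := Polynomial.degree_modByMonic_lt T hZm
  have hmodn : (T %ₘ Z).natDegree < p :=
    hZdeg ▸ Polynomial.natDegree_modByMonic_lt T hZm (by rintro h; simp [h] at hZdeg; omega)
  have hu := Polynomial.div_modByMonic_unique (f := T) (g := Z) (Polynomial.taylor 1 (T /ₘ Z))
    (Polynomial.taylor 1 (T %ₘ Z)) hZm ⟨by
      conv_rhs => rw [← hT, ← Polynomial.modByMonic_add_div T Z]
      rw [map_add, Polynomial.taylor_mul, hZt], by simpa using hmod⟩
  have hq := eq_C_of_taylor_one_eq (p := p) hu.1.symm (by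
    rw [Polynomial.natDegree_divByMonic T hZm, hZdeg]; omega)
  have hr := eq_C_of_taylor_one_eq (p := p) hu.2.symm hmodn
  have hdecomp := Polynomial.modByMonic_add_div T Z
  rw [hq, hr] at hdecomp
  generalize (T /ₘ Z).eval 0 = q at hdecomp
  generalize (T %ₘ Z).eval 0 = r at hdecomp
  rw [← hdecomp]
  have h0 : p ≠ 0 := by omega
  have h1 : (1 : ℕ) ≠ p := by omega
  simp [hZ, h0, Polynomial.coeff_C, Polynomial.coeff_X, h1]
  ring

theorem sum_natCast_pow_eq_zero {n : ℕ} (hn : n < p - 1) :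
    ∑ k ∈ Finset.range p, (k : K) ^ n = 0 := by
  have h := FiniteField.sum_pow_lt_card_sub_one (ZMod p) n (by simpa using hn)
  have h2 := congrArg (ZMod.castHom (dvd_refl p) K) h
  rw [map_zero, map_sum] at h2
  rw [← h2]
  refine Finset.sum_bij (fun k _ => (k : ZMod p)) (by simp) ?_ ?_ (by simp)
  · intro i hi j hj h
    exact CharP.natCast_injOn_Iio (ZMod p) p (by simpa using hi) (by simpa using hj) h
  · intro b _
    exact ⟨b.val, by simpa using ZMod.val_lt b, by simp⟩

theorem coeff_sum_taylor_eq_zero {P : Polynomial K} (hdeg : P.natDegree < 2 * p - 1) :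
    (∑ k ∈ Finset.range p, Polynomial.taylor (k : K) P).coeff p = 0 := by
  have hp1 : 1 < p := (Fact.out : p.Prime).one_lt
  have hlt : (Polynomial.hasseDeriv p P).natDegree < p - 1 := by
    have := Polynomial.natDegree_hasseDeriv_le P p
    omega
  simp only [Polynomial.finsetSum_coeff, Polynomial.taylor_coeff,
    Polynomial.eval_eq_sum_range]
  rw [Finset.sum_comm]
  refine Finset.sum_eq_zero fun n hn => ?_
  have hn := Finset.mem_range.mp hn
  rw [← Finset.mul_sum, sum_natCast_pow_eq_zero (by omega), mul_zero]

end ShiftInvariant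

section TraceShift

variable {K : Type*} [Field K]

theorem trace_descProd_of_lower_triangular {S : Type*} [CommRing S]
    {B : ℕ → Matrix (Fin 2) (Fin 2) S} (hB : ∀ k, B k 0 1 = 0) (n : ℕ) :
    (descProd B n).trace =
      ∏ k ∈ Finset.range n, B k 0 0 + ∏ k ∈ Finset.range n, B k 1 1 := by
  have h : descProd B n 0 1 = 0 ∧ descProd B n 0 0 = ∏ k ∈ Finset.range n, B k 0 0 ∧
      descProd B n 1 1 = ∏ k ∈ Finset.range n, B k 1 1 := by
    induction n with
    | zero => simp [descProd]
    | succ n ih =>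
      obtain ⟨h1, h2, h3⟩ := ih
      simp [descProd, Matrix.mul_apply, Fin.sum_univ_two, Finset.prod_range_succ, h1, h2, h3,
        hB, mul_comm]
  rw [Matrix.trace_fin_two, h.2.1, h.2.2]

theorem coeff_prod_taylor (p : ℕ) {P : Polynomial K} (hP : P.natDegree ≤ 1) :
    (∏ k ∈ Finset.range p, Polynomial.taylor (k : K) P).coeff p = P.coeff 1 ^ p := by
  have h := Polynomial.coeff_prod_of_natDegree_le (Finset.range p)
    (fun k => Polynomial.taylor (k : K) P) 1 (by simpa using fun _ _ => hP)
  rw [Finset.card_range, mul_one] at h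
  rw [h, Finset.prod_eq_pow_card (b := P.coeff 1), Finset.card_range]
  intro k _
  obtain ⟨u, v, rfl⟩ := Polynomial.exists_eq_X_add_C_of_natDegree_le_one hP
  simp [Polynomial.coeff_X, Polynomial.coeff_C]

/-- The deformation of a `2 × 2` matrix in which its upper right entry is multiplied by the
deformation variable. -/
noncomputable def deform (B : Matrix (Fin 2) (Fin 2) (Polynomial K)) :
    Matrix (Fin 2) (Fin 2) (Polynomial (Polynomial K)) :=
  !![Polynomial.C (B 0 0), Polynomial.X * Polynomial.C (B 0 1);
    Polynomial.C (B 1 0), Polynomial.C (B 1 1)]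

/-- Translation of the spectral variable by `x`, as a ring homomorphism. -/
noncomputable def translateHom (x : K) : Polynomial K →+* Polynomial K :=
  (Polynomial.taylorAlgHom x).toRingHom

@[simp]
theorem translateHom_apply (x : K) (P : Polynomial K) :
    translateHom x P = Polynomial.taylor x P := rfl

theorem translateHom_comp_translateHom (x y : K) :
    (translateHom x).comp (translateHom y) = translateHom (x + y) :=
  RingHom.ext fun P => by simp [Polynomial.taylor_taylor]

/-- The deformed matrix with spectral variable translated by `k`. -/
noncomputable def deformSeq (B : Matrix (Fin 2) (Fin 2) (Polynomial K)) (k : ℕ) :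
    Matrix (Fin 2) (Fin 2) (Polynomial (Polynomial K)) :=
  (Polynomial.mapRingHom (translateHom (k : K))).mapMatrix (deform B)

theorem deform_mapMatrix (B : Matrix (Fin 2) (Fin 2) (Polynomial K))
    (τ : Polynomial K →+* Polynomial K) :
    (Polynomial.mapRingHom τ).mapMatrix (deform B) = deform (τ.mapMatrix B) := by
  ext1 i j
  fin_cases i <;> fin_cases j <;> simp [deform]

theorem mapMatrix_deformSeq (B : Matrix (Fin 2) (Fin 2) (Polynomial K)) (k j : ℕ) :
    (Polynomial.mapRingHom (translateHom (k : K))).mapMatrix (deformSeq B j) =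
      deformSeq B (k + j) := by
  ext1 a b
  simp [deformSeq, Polynomial.map_map, translateHom_comp_translateHom]

variable {B : Matrix (Fin 2) (Fin 2) (Polynomial K)}

theorem isWeighted_deformSeq (k : ℕ) :
    IsWeighted (fun i => halfDegreeLE (Polynomial K) i) 1 (deformSeq B k) := by
  rw [deformSeq, deform_mapMatrix]
  refine ⟨mem_halfDegreeLE_of_natDegree_le (n := 0) (by simp [deform]) (by norm_num),
    mem_halfDegreeLE_of_natDegree_le (n := 1) ?_ (by norm_num),
    mem_halfDegreeLE_of_natDegree_le (n := 0) (by simp [deform]) (by norm_num),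
    mem_halfDegreeLE_of_natDegree_le (n := 0) (by simp [deform]) (by norm_num)⟩
  change (Polynomial.X * Polynomial.C _).natDegree ≤ 1
  exact (Polynomial.natDegree_mul_C_le _ _).trans Polynomial.natDegree_X_le

theorem isWeighted_coeffFiltration_deformSeq
    (h00 : (B 0 0).natDegree ≤ 1) (h01 : (B 0 1).natDegree ≤ 2)
    (h10 : (B 1 0).natDegree ≤ 1) (h11 : (B 1 1).natDegree ≤ 1)
    (k : ℕ) :
    IsWeighted (fun i => coeffFiltration (halfDegreeLE K i)) 3 (deformSeq B k) := by
  rw [deformSeq, deform_mapMatrix]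
  exact ⟨C_mem_coeffFiltration (mem_halfDegreeLE_of_natDegree_le (n := 1) (by simpa) (by norm_num)),
    X_mul_C_mem_coeffFiltration (mem_halfDegreeLE_of_natDegree_le (n := 2) (by simpa) (by norm_num)),
    C_mem_coeffFiltration (mem_halfDegreeLE_of_natDegree_le (n := 1) (by simpa) (by norm_num)),
    C_mem_coeffFiltration (mem_halfDegreeLE_of_natDegree_le (n := 1) (by simpa) (by norm_num))⟩

theorem isWeighted_map_derivative {S : Type*} [CommRing S] {i : ℤ}
    {A : Matrix (Fin 2) (Fin 2) (Polynomial (Polynomial S))}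
    (hA : IsWeighted (fun i => coeffFiltration (halfDegreeLE S i)) i A) :
    IsWeighted (fun i => coeffFiltration (halfDegreeLE S i)) i (A.map Polynomial.derivative) := by
  have key : ∀ (j : ℤ) (P : Polynomial (Polynomial S)), P ∈ coeffFiltration (halfDegreeLE S j) →
      Polynomial.derivative P ∈ coeffFiltration (halfDegreeLE S j) := by
    intro j P hP n
    rw [Polynomial.coeff_derivative, mul_comm, ← Nat.cast_succ, ← nsmul_eq_mul]
    exact nsmul_mem (hP _) _
  exact ⟨key _ _ hA.1, key _ _ hA.2.1, key _ _ hA.2.2.1, key _ _ hA.2.2.2⟩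

theorem mul_mem_coeffFiltration_halfDegreeLE (i j : ℤ) : ∀ x ∈ coeffFiltration (halfDegreeLE K i),
    ∀ y ∈ coeffFiltration (halfDegreeLE K j), x * y ∈ coeffFiltration (halfDegreeLE K (i + j)) :=
  fun _ hx _ hy => mul_mem_coeffFiltration (fun _ hx _ hy => mul_mem_halfDegreeLE hx hy) hx hy

theorem one_mem_coeffFiltration :
    (1 : Polynomial (Polynomial K)) ∈ coeffFiltration (halfDegreeLE K 0) :=
  C_mem_coeffFiltration (mem_halfDegreeLE_of_natDegree_le (n := 0) (by simp) (by simp))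

theorem eval_deformSeq_one (k : ℕ) :
    (Polynomial.evalRingHom 1).mapMatrix (deformSeq B k) = (translateHom (k : K)).mapMatrix B := by
  rw [deformSeq, deform_mapMatrix]
  ext1 i j
  fin_cases i <;> fin_cases j <;> simp [deform]

variable {p : ℕ} [Fact p.Prime] [CharP K p]

theorem coeff_coeff_trace_deformSeq
    (h00 : (B 0 0).natDegree ≤ 1) (h01 : (B 0 1).natDegree ≤ 2)
    (h10 : (B 1 0).natDegree ≤ 1) (h11 : (B 1 1).natDegree ≤ 1)
    (hp : 2 < p) {l : ℕ} (hl : l ≠ 0) :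
    ((descProd (deformSeq B) p).trace.coeff l).coeff p = 0 := by
  by_cases hlp : l < p
  · have hper : ∀ k, deformSeq B (p + k) = deformSeq B k := by simp [deformSeq]
    have hw := isWeighted_coeffFiltration_deformSeq h00 h01 h10 h11
    set G := ((deformSeq B 0).map Polynomial.derivative *
      descProd (fun j => deformSeq B (1 + j)) (p - 1)).trace with hG
    have hGmem : G ∈ coeffFiltration (halfDegreeLE K (3 + (p - 1 : ℕ) * 3)) :=
      ((isWeighted_map_derivative (hw 0)).mul mul_mem_coeffFiltration_halfDegreeLE
        (IsWeighted.descProd mul_mem_coeffFiltration_halfDegreeLE one_mem_coeffFiltration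
          (fun j => hw (1 + j)) (p - 1))).trace_mem
    have hder : Polynomial.derivative (descProd (deformSeq B) p).trace =
        ∑ k ∈ Finset.range p, Polynomial.mapRingHom (translateHom (k : K)) G := by
      rw [derivative_trace_descProd hper]
      refine Finset.sum_congr rfl fun k _ => ?_
      have hmap : (deformSeq B k).map Polynomial.derivative =
          (Polynomial.mapRingHom (translateHom (k : K))).mapMatrix
            ((deformSeq B 0).map Polynomial.derivative) := by
        rw [← add_zero k, ← mapMatrix_deformSeq, add_zero]
        ext1 i j
        simp [Polynomial.derivative_map]
      rw [hG, AddMonoidHom.map_trace, hmap]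
      change _ = ((Polynomial.mapRingHom (translateHom (k : K))).mapMatrix _).trace
      rw [map_mul, map_descProd]
      simp only [mapMatrix_deformSeq, add_assoc]
    have hl1 : l - 1 + 1 = l := by omega
    have hc := congrArg (fun P => (P.coeff (l - 1)).coeff p) hder
    simp only [Polynomial.coeff_derivative, hl1, Polynomial.finsetSum_coeff,
      Polynomial.coe_mapRingHom, Polynomial.coeff_map, translateHom_apply] at hc
    rw [← Polynomial.finsetSum_coeff, coeff_sum_taylor_eq_zero (natDegree_lt_of_mem_halfDegreeLE
      (by omega) (hGmem (l - 1)) (by omega)), ← Nat.cast_succ, Nat.succ_eq_add_one, hl1,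
      Polynomial.coeff_mul_natCast] at hc
    refine (mul_eq_zero.mp hc).resolve_right fun h => ?_
    exact Nat.not_dvd_of_pos_of_lt (by omega) hlp ((CharP.cast_eq_zero_iff K p l).mp h)
  · have h := (IsWeighted.descProd (fun _ _ _ hx _ hy => mul_mem_halfDegreeLE hx hy)
      (mem_halfDegreeLE_of_natDegree_le (n := 0) (by simp) (by simp))
      (isWeighted_deformSeq (B := B)) p).trace_mem
    rw [h l (by omega), Polynomial.coeff_zero]

theorem coeff_trace_descProd_translate
    (h00 : (B 0 0).natDegree ≤ 1) (h01 : (B 0 1).natDegree ≤ 2)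
    (h10 : (B 1 0).natDegree ≤ 1) (h11 : (B 1 1).natDegree ≤ 1)
    (hp : 2 < p) :
    (descProd (fun k => (translateHom (k : K)).mapMatrix B) p).trace.coeff p =
      ((B 0 0).coeff 1 + (B 1 1).coeff 1) ^ p := by
  set T := (descProd (deformSeq B) p).trace with hT
  have hone : (descProd (fun k => (translateHom (k : K)).mapMatrix B) p).trace = T.eval 1 := by
    rw [← Polynomial.coe_evalRingHom, hT, map_trace_descProd]
    simp only [eval_deformSeq_one]
  have hzero : T.coeff 0 = ∏ k ∈ Finset.range p, Polynomial.taylor (k : K) (B 0 0) +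
      ∏ k ∈ Finset.range p, Polynomial.taylor (k : K) (B 1 1) := by
    rw [← Polynomial.constantCoeff_apply, hT, map_trace_descProd, trace_descProd_of_lower_triangular]
    · simp [deformSeq, deform]
    · simp [deformSeq, deform]
  rw [hone, Polynomial.eval_eq_sum_range, Polynomial.finsetSum_coeff,
    Finset.sum_eq_single_of_mem 0 (by simp)]
  · rw [one_pow, mul_one, hzero, Polynomial.coeff_add, coeff_prod_taylor p h00,
      coeff_prod_taylor p h11, add_pow_char]
  · intro l _ hl
    rw [one_pow, mul_one]
    exact coeff_coeff_trace_deformSeq h00 h01 h10 h11 hp hl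

theorem trace_descProd_eval_add
    (h00 : (B 0 0).natDegree ≤ 1) (h01 : (B 0 1).natDegree ≤ 2)
    (h10 : (B 1 0).natDegree ≤ 1) (h11 : (B 1 1).natDegree ≤ 1)
    (hp : 2 < p) (x : K) :
    (descProd (fun k : ℕ => B.map (Polynomial.eval (x + k))) p).trace =
      (descProd (fun k : ℕ => B.map (Polynomial.eval (k : K))) p).trace +
        ((B 0 0).coeff 1 + (B 1 1).coeff 1) ^ p * (x ^ p - x) := by
  set T := (descProd (fun k => (translateHom (k : K)).mapMatrix B) p).trace with hT
  have heval : ∀ y : K, T.eval y =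
      (descProd (fun k : ℕ => B.map (Polynomial.eval (y + k))) p).trace := by
    intro y
    rw [← Polynomial.coe_evalRingHom, hT, map_trace_descProd]
    congr 2
    funext k
    ext1 i j
    simp [Polynomial.taylor_eval]
  have hinv : Polynomial.taylor 1 T = T := by
    rw [← translateHom_apply, hT, map_trace_descProd]
    have h := trace_descProd_rotate (fun _ => 1)
      (fun k : ℕ => (translateHom (k : K)).mapMatrix B) (Fact.out : p.Prime).ne_zero (by simp)
    simp only [one_mul, mul_one] at h
    rw [h]
    congr 2
    funext k
    ext1 i j
    simp [Polynomial.taylor_taylor, add_comm]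
  have hdeg : T.natDegree < 2 * p := by
    have h := (IsWeighted.descProd (F := fun i => halfDegreeLE K i)
      (fun _ _ _ hx _ hy => mul_mem_halfDegreeLE hx hy)
      (mem_halfDegreeLE_of_natDegree_le (n := 0) (by simp) (by simp))
      (B := fun k : ℕ => (translateHom (k : K)).mapMatrix B) (i := 3) (fun k =>
        ⟨mem_halfDegreeLE_of_natDegree_le (n := 1) (by simpa) (by norm_num),
        mem_halfDegreeLE_of_natDegree_le (n := 2) (by simpa) (by norm_num),
        mem_halfDegreeLE_of_natDegree_le (n := 1) (by simpa) (by norm_num),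
        mem_halfDegreeLE_of_natDegree_le (n := 1) (by simpa) (by norm_num)⟩) p).trace_mem
    exact natDegree_lt_of_mem_halfDegreeLE (by omega) h (by push_cast; omega)
  rw [← heval, eval_eq_of_taylor_one_eq hinv hdeg, heval,
    coeff_trace_descProd_translate h00 h01 h10 h11 hp]
  simp only [zero_add]

end TraceShift

section DressingChain

/-- The elementary factor `[[f, x], [1, 0]]`. -/
def chainFactor {S : Type*} [CommRing S] (f x : S) : Matrix (Fin 2) (Fin 2) S := !![f, x; 1, 0]

/-- The product of three elementary factors, with spectral variable `z`. -/
def chainMatrix {S : Type*} [CommRing S] (f₀ f₁ f₂ β₀ β₁ β₂ z : S) : Matrix (Fin 2) (Fin 2) S :=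
  chainFactor f₀ (z + β₀) * chainFactor f₁ (z + β₁) * chainFactor f₂ (z + β₂)

theorem chainMatrix_eq {S : Type*} [CommRing S] (f₀ f₁ f₂ β₀ β₁ β₂ z : S) :
    chainMatrix f₀ f₁ f₂ β₀ β₁ β₂ z =
      !![(f₀ + f₂) * z + (f₀ * f₁ * f₂ + f₂ * β₀ + f₀ * β₁), (f₀ * f₁ + β₀ + z) * (z + β₂);
        z + (f₁ * f₂ + β₁), f₁ * z + f₁ * β₂] := by
  simp only [chainMatrix, chainFactor, Matrix.mul_fin_two]
  ext1 i j
  fin_cases i <;> fin_cases j <;> simp <;> ring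

variable {K : Type*} [Field K]

/-- The trace of the product of `chainMatrix` over `p` consecutive values of the spectral
variable, starting at `z`. -/
def chainTrace (p : ℕ) (f₀ f₁ f₂ β₀ β₁ β₂ z : K) : K :=
  (descProd (fun k : ℕ => chainMatrix f₀ f₁ f₂ β₀ β₁ β₂ (z + k)) p).trace

theorem chainTrace_swap (p : ℕ) (f₀ f₁ f₂ β₀ β₁ β₂ z : K) {r : K} (h : r * f₁ = β₀ - β₁) :
    chainTrace p f₀ f₁ f₂ β₀ β₁ β₂ z = chainTrace p (f₀ + r) f₁ (f₂ - r) β₁ β₀ β₂ z := by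
  have hβ : β₀ = β₁ + r * f₁ := by rw [h]; ring
  unfold chainTrace
  congr 2
  funext k
  rw [chainMatrix_eq, chainMatrix_eq, hβ]
  ext1 i j
  fin_cases i <;> fin_cases j <;> simp [-mul_eq_mul_right_iff] <;> ring

theorem chainTrace_translate (p : ℕ) (f₀ f₁ f₂ β₀ β₁ β₂ z y : K) :
    chainTrace p f₀ f₁ f₂ (β₀ + y) (β₁ + y) (β₂ + y) z =
      chainTrace p f₀ f₁ f₂ β₀ β₁ β₂ (z + y) := by
  unfold chainTrace
  congr 2
  funext k
  rw [chainMatrix_eq, chainMatrix_eq]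
  ext1 i j
  fin_cases i <;> fin_cases j <;> simp <;> ring

variable {p : ℕ} [Fact p.Prime] [CharP K p]

theorem chainTrace_rotate (f₀ f₁ f₂ β₀ β₁ β₂ z : K) :
    chainTrace p f₀ f₁ f₂ β₀ β₁ β₂ z = chainTrace p f₂ f₀ f₁ (β₂ + 1) β₀ β₁ z := by
  have h := trace_descProd_rotate (p := p)
    (fun k : ℕ => chainFactor f₀ (z + k + β₀) * chainFactor f₁ (z + k + β₁))
    (fun k : ℕ => chainFactor f₂ (z + k + β₂)) (Fact.out : p.Prime).ne_zero (by simp)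
  unfold chainTrace chainMatrix
  rw [h]
  congr 2
  funext k
  rw [mul_assoc]
  congr 2
  push_cast
  ring

theorem chainTrace_eq_add (hp : 2 < p) (f₀ f₁ f₂ β₀ β₁ β₂ z : K) :
    chainTrace p f₀ f₁ f₂ β₀ β₁ β₂ z =
      chainTrace p f₀ f₁ f₂ β₀ β₁ β₂ 0 + (f₀ + f₁ + f₂) ^ p * (z ^ p - z) := by
  have hlin : ∀ u v : K,
      (Polynomial.C u * Polynomial.X + Polynomial.C v).natDegree ≤ 1 := fun u v =>
    Polynomial.natDegree_linear_le
  set B : Matrix (Fin 2) (Fin 2) (Polynomial K) :=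
    chainMatrix (Polynomial.C f₀) (Polynomial.C f₁) (Polynomial.C f₂) (Polynomial.C β₀)
      (Polynomial.C β₁) (Polynomial.C β₂) Polynomial.X with hB
  have h00 : B 0 0 = Polynomial.C (f₀ + f₂) * Polynomial.X +
      Polynomial.C (f₀ * f₁ * f₂ + f₂ * β₀ + f₀ * β₁) := by simp [hB, chainMatrix_eq]
  have h01 : B 0 1 = (Polynomial.C 1 * Polynomial.X + Polynomial.C (f₀ * f₁ + β₀)) *
      (Polynomial.C 1 * Polynomial.X + Polynomial.C β₂) := by
    simp [hB, chainMatrix_eq, add_comm]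
  have h10 : B 1 0 = Polynomial.C 1 * Polynomial.X + Polynomial.C (f₁ * f₂ + β₁) := by
    simp [hB, chainMatrix_eq]
  have h11 : B 1 1 = Polynomial.C f₁ * Polynomial.X + Polynomial.C (f₁ * β₂) := by
    simp [hB, chainMatrix_eq]
  have heval : ∀ w : K, B.map (Polynomial.eval w) = chainMatrix f₀ f₁ f₂ β₀ β₁ β₂ w := by
    intro w
    ext1 i j
    fin_cases i <;> fin_cases j <;> simp [hB, chainMatrix_eq]
  have h := trace_descProd_eval_add (B := B) (by rw [h00]; exact hlin _ _)
    (by rw [h01]; exact Polynomial.natDegree_mul_le_of_le (hlin _ _) (hlin _ _))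
    (by rw [h10]; exact hlin _ _) (by rw [h11]; exact hlin _ _) hp z
  simp only [heval, h00, h11] at h
  simp only [chainTrace, zero_add]
  rw [h]
  simp [Polynomial.coeff_C, add_right_comm]

end DressingChain

theorem evalP_Ip_s4 (p : ℕ) [Fact p.Prime] (K : Type*) [Field K] [CharP K p] (a b c d e : K) :
    evalP p (Ip p) K a b c d e = chainTrace p (a - b + e) b (-a) d 0 (-c) 0 := by
  set φ : R p →+* K := eval₂Hom (ZMod.castHom (dvd_refl p) K) ![a, b, c, d, e]
  have hf : φ (fP p) = a := by simp [φ, fP]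
  have hg : φ (gP p) = b := by simp [φ, gP]
  have h1 : φ (a1P p) = c := by simp [φ, a1P]
  have h2 : φ (a2P p) = d := by simp [φ, a2P]
  have ht : φ (tP p) = e := by simp [φ, tP]
  change φ (Ip p) = _
  have hI : Ip p = (descProd (fun k : ℕ => AM p (RingHom.id (R p)) (k : R p)) p).trace := by
    rw [Ip, ← list_prod_reverse_range]
    simp [← List.map_eq_flatMap]
    rfl
  rw [hI, map_trace_descProd, chainTrace]
  refine trace_descProd_gauge
    (Q := fun k : ℕ => !![e * k + e * a * b - b, 1; 1, 0])
    (V := !![0, 1; 1, -(e * a * b - b)]) (fun k => ?_) (by simp) ?_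
  · rw [chainMatrix_eq]
    ext1 i j
    fin_cases i <;> fin_cases j <;>
      simp [AM, A0, A1, A2, A3, hP, hf, hg, h1, h2, ht, Matrix.mul_apply, Fin.sum_univ_two] <;>
      ring
  · ext1 i j
    fin_cases i <;> fin_cases j <;> simp [Matrix.mul_apply, Fin.sum_univ_two]

theorem evalP_Itil (p : ℕ) [Fact p.Prime] (K : Type*) [Field K] [CharP K p] (a b c d e : K) :
    evalP p (Itil p) K a b c d e = chainTrace p (a - b + e) b (-a) d 0 (-c) 0 +
      3⁻¹ * e ^ p * (c ^ p - c - d ^ p + d) := by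
  rw [← evalP_Ip_s4]
  have h3 : ZMod.castHom (dvd_refl p) K 3⁻¹ = 3⁻¹ := by rw [map_inv₀, map_ofNat]
  simp only [evalP, Itil, a1P, a2P, tP, eval₂_add, eval₂_mul, eval₂_sub, eval₂_pow, eval₂_C,
    eval₂_X, h3]
  simp

/-- For a prime `p ≥ 5`, the normalised integral `Ĩ_p` is completely
invariant under the generators `s₀, s₁, s₂, π` of the extended affine Weyl group
`W̃(A₂⁽¹⁾)`. -/
theorem Itil_Weyl_invariant (p : ℕ) (hp : p.Prime) (hp5 : 5 ≤ p)
    (K : Type*) [Field K] [CharP K p] (a b c d e : K) :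
    (a - b + e ≠ 0 →
      evalP p (Itil p) K
        (a + (c + d - 1) / (a - b + e)) (b + (c + d - 1) / (a - b + e)) (1 - d) (1 - c) e
      = evalP p (Itil p) K a b c d e) ∧
    (a ≠ 0 →
      evalP p (Itil p) K a (b - c / a) (-c) (d + c) e = evalP p (Itil p) K a b c d e) ∧
    (b ≠ 0 →
      evalP p (Itil p) K (a + d / b) b (c + d) (-d) e = evalP p (Itil p) K a b c d e) ∧
    (evalP p (Itil p) K (-b) (a - b + e) d (1 - c - d) e = evalP p (Itil p) K a b c d e) := by
  have : Fact p.Prime := ⟨hp⟩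
  have h3 : (3 : K) ≠ 0 := by
    intro h
    have : p ∣ 3 := (CharP.cast_eq_zero_iff K p 3).mp (by exact_mod_cast h)
    exact absurd (Nat.le_of_dvd (by norm_num) this) (by omega)
  have hp2 : 2 < p := by omega
  have hneg : ∀ x : K, (-x) ^ p = -x ^ p := (hp.odd_of_ne_two (by omega)).neg_pow
  refine ⟨fun h => ?_, fun h => ?_, fun h => ?_, ?_⟩
  · set r := (c + d - 1) / (a - b + e) with hr
    have hr' : r * (a - b + e) = c + d - 1 := div_mul_cancel₀ _ h
    have hnew : chainTrace p (a + r - (b + r) + e) (b + r) (-(a + r)) (1 - c) 0 (-(1 - d)) 0 =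
        chainTrace p (a - b + e) b (-a) d 0 (-c) 0 := by
      rw [chainTrace_rotate (a - b + e), chainTrace_rotate,
        chainTrace_swap p (-a) _ _ _ _ _ _ (r := -r) (by linear_combination -hr')]
      congr 1 <;> ring
    rw [evalP_Itil, evalP_Itil, hnew]
    simp only [sub_pow_char, one_pow]
    ring
  · set r := c / a with hr
    have hr' : r * a = c := div_mul_cancel₀ _ h
    have hnew : chainTrace p (a - (b - r) + e) (b - r) (-a) (d + c) 0 (- -c) 0 =
        chainTrace p (a - b + e) b (-a) d 0 (-c) 0 + e ^ p * (c ^ p - c) := by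
      have hold : chainTrace p (a - b + e) b (-a) d 0 (-c) 0 =
          chainTrace p (a - b + e + r) (b - r) (-a) d (-c) 0 0 := by
        rw [chainTrace_rotate, chainTrace_rotate, chainTrace_rotate (a - b + e + r),
          chainTrace_rotate (-a) (a - b + e + r),
          chainTrace_swap p b _ _ _ _ _ _ (r := -r) (by linear_combination hr')]
        congr 1 <;> ring
      have hshift := chainTrace_translate p (a - b + e + r) (b - r) (-a) d (-c) 0 0 c
      rw [chainTrace_eq_add hp2 _ _ _ _ _ _ (0 + c), ← hold] at hshift
      convert! hshift using 2 <;> ring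
    rw [evalP_Itil, evalP_Itil, hnew, hneg, add_pow_char]
    field_simp
    ring
  · set r := d / b with hr
    have hr' : r * b = d := div_mul_cancel₀ _ h
    have hnew : chainTrace p (a + r - b + e) b (-(a + r)) (-d) 0 (-(c + d)) 0 =
        chainTrace p (a - b + e) b (-a) d 0 (-c) 0 - e ^ p * (d ^ p - d) := by
      have hshift := chainTrace_translate p (a - b + e + r) b (-a - r) 0 d (-c) 0 (-d)
      rw [chainTrace_eq_add hp2 _ _ _ _ _ _ (0 + -d),
        ← chainTrace_swap p (a - b + e) b (-a) d 0 (-c) 0 (by linear_combination hr'),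
        zero_add, hneg, show a - b + e + r + b + (-a - r) = e by ring] at hshift
      rw [show chainTrace p (a - b + e) b (-a) d 0 (-c) 0 - e ^ p * (d ^ p - d) =
        chainTrace p (a - b + e) b (-a) d 0 (-c) 0 + e ^ p * (-d ^ p - -d) by ring, ← hshift]
      congr 1 <;> ring
    rw [evalP_Itil, evalP_Itil, hnew, hneg, add_pow_char]
    field_simp
    ring
  · have hnew : chainTrace p (-b - (a - b + e) + e) (a - b + e) (- -b) (1 - c - d) 0 (-d) 0 =
        chainTrace p (a - b + e) b (-a) d 0 (-c) 0 - e ^ p * (d ^ p - d) := by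
      have hshift := chainTrace_translate p (-a) (a - b + e) b (-c + 1) d 0 0 (-d)
      rw [chainTrace_eq_add hp2 _ _ _ _ _ _ (0 + -d),
        ← chainTrace_rotate, zero_add, hneg, show -a + (a - b + e) + b = e by ring] at hshift
      rw [show chainTrace p (a - b + e) b (-a) d 0 (-c) 0 - e ^ p * (d ^ p - d) =
        chainTrace p (a - b + e) b (-a) d 0 (-c) 0 + e ^ p * (-d ^ p - -d) by ring, ← hshift]
      congr 1 <;> ring
    rw [evalP_Itil, evalP_Itil, hnew]
    simp only [sub_pow_char, one_pow]
    field_simp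
    ring
end

section
/- Let p = 2 and define the normalised integral Ĩ₂ = I₂ + (1 + t²)·(α₁² + α₁ + α₂² + α₂) ∈ R. Then Ĩ₂ is completely invariant under the extended affine Weyl group action: for every field K of characteristic 2 and a, b, c, d, e ∈ K, (i) if a − b + e ≠ 0 then, with r = (c + d − 1)/(a − b + e), Ĩ₂(a + r, b + r, 1 − d, 1 − c, e) = Ĩ₂(a, b, c, d, e) (generator s₀); (ii) if a ≠ 0 then Ĩ₂(a, b − c/a, −c, d + c, e) = Ĩ₂(a, b, c, d, e) (generator s₁); (iii) if b ≠ 0 then Ĩ₂(a + d/b, b, c + d, −d, e) = Ĩ₂(a, b, c, d, e) (generator s₂); (iv) Ĩ₂(−b, a − b + e, d, 1 − c − d, e) = Ĩ₂(a, b, c, d, e) (generator π). Here Ĩ₂(·) denotes evaluation of Ĩ₂ at (f, g, α₁, α₂, t) equal to the indicated tuple. -/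
open MvPolynomial

/-- The normalised integral `Ĩ₂ = I₂ + (1 + t²)·(α₁² + α₁ + α₂² + α₂)` in characteristic 2. -/
noncomputable def Itil2 : R 2 :=
  Ip 2 + (1 + tP 2 ^ 2) * (a1P 2 ^ 2 + a1P 2 + a2P 2 ^ 2 + a2P 2)

/-- Closed form of `Ĩ₂` on a ring of characteristic 2, with
`v = α₁·g + α₂·f + f·g·(f + g + t)`:
`Ĩ₂ = v² + t·v + f·g + α₁·α₂ + (1 + t²)·(α₁² + α₁ + α₂² + α₂)`. -/
theorem evalP_Itil2 (K : Type*) [CommRing K] [CharP K 2] (a b c d e : K) :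
    evalP 2 Itil2 K a b c d e =
      (c * b + d * a + a * b * (a + b + e)) ^ 2 + e * (c * b + d * a + a * b * (a + b + e))
        + a * b + c * d + (1 + e ^ 2) * (c ^ 2 + c + d ^ 2 + d) := by
  simp [evalP, Itil2, Ip, AM, A0, A1, A2, A3, hP, fP, gP, a1P, a2P, tP, List.range_succ,
    Matrix.trace_fin_two]
  grind

/-- The normalised integral `Ĩ₂` is completely invariant under the
generators `s₀, s₁, s₂, π` of the extended affine Weyl group `W̃(A₂⁽¹⁾)`. -/
theorem Itil2_Weyl_invariant (K : Type*) [Field K] [CharP K 2] (a b c d e : K) :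
    (a - b + e ≠ 0 →
      evalP 2 Itil2 K
        (a + (c + d - 1) / (a - b + e)) (b + (c + d - 1) / (a - b + e)) (1 - d) (1 - c) e
      = evalP 2 Itil2 K a b c d e) ∧
    (a ≠ 0 →
      evalP 2 Itil2 K a (b - c / a) (-c) (d + c) e = evalP 2 Itil2 K a b c d e) ∧
    (b ≠ 0 →
      evalP 2 Itil2 K (a + d / b) b (c + d) (-d) e = evalP 2 Itil2 K a b c d e) ∧
    (evalP 2 Itil2 K (-b) (a - b + e) d (1 - c - d) e = evalP 2 Itil2 K a b c d e) := by
  simp only [evalP_Itil2]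
  refine ⟨fun h => ?_, fun h => ?_, fun h => ?_, ?_⟩ <;> grind
end

section
/- Let p be a prime. The polynomial χ_p(Z) ∈ R[Z] takes the form i₀ + i₁·Z + i_p·Z^p with i₁ + i_p = 0 and i₀ = I_p; precisely: the coefficient of Z^k in χ_p vanishes for every natural number k with k ∉ {0, 1, p}, the coefficient of Z¹ plus the coefficient of Z^p equals 0, and the coefficient of Z⁰ equals I_p. -/
open MvPolynomial

/-- `χ_p(Z) = Tr[A(Z + p − 1)·A(Z + p − 2)·⋯·A(Z + 1)·A(Z)] ∈ R[Z]`. -/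
noncomputable def chi (p : ℕ) : Polynomial (R p) :=
  Matrix.trace (((List.range p).reverse.map
    (fun k => AM p (Polynomial.C : R p →+* Polynomial (R p))
      (Polynomial.X + Polynomial.C (k : R p)))).prod)

/-! ### Trace of the ordered product of shifted Lax matrices -/

/-- The trace of `A(x + p − 1)⋯A(x + 1)·A(x)` over a ring `S` receiving a map from `R`. -/
noncomputable def shiftTrace (p : ℕ) {S : Type*} [CommRing S] (φ : R p →+* S) (x : S) : S :=
  Matrix.trace (((List.range p).reverse.map (fun k : ℕ => AM p φ (x + (k : S)))).prod)

theorem AM_map (p : ℕ) {S T : Type*} [CommRing S] [CommRing T] (φ : R p →+* S) (ψ : S →+* T)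
    (z : S) : (AM p φ z).map ψ = AM p (ψ.comp φ) (ψ z) := by
  ext i j
  simp [AM]

theorem map_shiftTrace (p : ℕ) {S T : Type*} [CommRing S] [CommRing T] (φ : R p →+* S)
    (ψ : S →+* T) (x : S) :
    ψ (shiftTrace p φ x) = shiftTrace p (ψ.comp φ) (ψ x) := by
  have h (M : Matrix (Fin 2) (Fin 2) S) : ψ M.trace = (ψ.mapMatrix M).trace :=
    AddMonoidHom.map_trace ψ M
  rw [shiftTrace, h, map_list_prod, List.map_map, shiftTrace]
  congr 3
  funext k
  simp [AM_map]

theorem chi_eq_shiftTrace (p : ℕ) : chi p = shiftTrace p Polynomial.C Polynomial.X := by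
  simp [chi, shiftTrace, ← List.map_eq_flatMap, Function.comp_def]

theorem Ip_eq_shiftTrace (p : ℕ) : Ip p = shiftTrace p (RingHom.id (R p)) 0 := by
  simp [Ip, shiftTrace, ← List.map_eq_flatMap, Function.comp_def]

theorem trace_reverse_range_prod_succ {n : Type*} [Fintype n] [DecidableEq n] {S : Type*}
    [CommRing S] (F : ℕ → Matrix n n S) (m : ℕ) (hF : F m = F 0) :
    (((List.range m).reverse.map (fun k => F (k + 1))).prod).trace =
      (((List.range m).reverse.map F).prod).trace := by
  cases m with
  | zero => simp
  | succ m =>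
    conv_rhs => rw [List.range_succ_eq_map]
    rw [List.range_succ]
    simp only [List.reverse_append, List.reverse_cons, List.reverse_nil, List.nil_append,
      List.map_append, List.map_cons, List.map_nil, List.prod_append, List.prod_cons,
      List.prod_nil, mul_one, hF, ← List.map_reverse, List.map_map]
    rw [Matrix.trace_mul_comm]
    rfl

theorem shiftTrace_add_one (p : ℕ) {S : Type*} [CommRing S] [CharP S p] (φ : R p →+* S) (x : S) :
    shiftTrace p φ (x + 1) = shiftTrace p φ x := by
  have h := trace_reverse_range_prod_succ (fun k : ℕ => AM p φ (x + (k : S))) p (by simp)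
  rw [shiftTrace, shiftTrace, ← h]
  congr 3
  ext k : 1
  congr 1
  push_cast
  ring

/-! ### Degree bound -/

namespace Polynomial

/-- The `(i, j)` entry has degree at most `m + i - j`. -/
def GradedDegreeLE {S : Type*} [CommRing S] (m : ℕ) (M : Matrix (Fin 2) (Fin 2) S[X]) : Prop :=
  ∀ i j, (M i j).natDegree + j.val ≤ m + i.val

theorem GradedDegreeLE.mul {S : Type*} [CommRing S] {m n : ℕ}
    {M N : Matrix (Fin 2) (Fin 2) S[X]} (hM : GradedDegreeLE m M) (hN : GradedDegreeLE n N) :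
    GradedDegreeLE (m + n) (M * N) := by
  intro i j
  have hterm (k : Fin 2) : (M i k * N k j).natDegree + j.val ≤ m + n + i.val := by
    have := natDegree_mul_le (p := M i k) (q := N k j)
    have := hM i k
    have := hN k j
    omega
  rw [Matrix.mul_apply, Fin.sum_univ_two]
  have := natDegree_add_le (M i 0 * N 0 j) (M i 1 * N 1 j)
  have := hterm 0
  have := hterm 1
  omega

theorem GradedDegreeLE.add {S : Type*} [CommRing S] {m : ℕ}
    {M N : Matrix (Fin 2) (Fin 2) S[X]} (hM : GradedDegreeLE m M) (hN : GradedDegreeLE m N) :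
    GradedDegreeLE m (M + N) := by
  intro i j
  have := natDegree_add_le (M i j) (N i j)
  have := hM i j
  have := hN i j
  rw [Matrix.add_apply]
  omega

theorem GradedDegreeLE.mono {S : Type*} [CommRing S] {m n : ℕ} (hmn : m ≤ n)
    {M : Matrix (Fin 2) (Fin 2) S[X]} (hM : GradedDegreeLE m M) : GradedDegreeLE n M :=
  fun i j => (hM i j).trans (Nat.add_le_add_right hmn _)

theorem GradedDegreeLE.natDegree_trace_le {S : Type*} [CommRing S] {m : ℕ}
    {M : Matrix (Fin 2) (Fin 2) S[X]} (hM : GradedDegreeLE m M) : M.trace.natDegree ≤ m := by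
  rw [Matrix.trace_fin_two]
  have := natDegree_add_le (M 0 0) (M 1 1)
  have := hM 0 0
  have := hM 1 1
  omega

end Polynomial

namespace Polynomial

/-- The part of `A(X + c)` of top graded degree; it does not depend on `c`. -/
noncomputable def laxLeading (p : ℕ) : Matrix (Fin 2) (Fin 2) (R p)[X] :=
  !![C (tP p) * X ^ 2, X; -(C (tP p ^ 2) * X ^ 3), -(C (tP p) * X ^ 2)]

theorem laxLeading_mul_self (p : ℕ) : laxLeading p * laxLeading p = 0 := by
  ext1 i j
  fin_cases i <;> fin_cases j <;> simp [laxLeading] <;> ring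

theorem gradedDegreeLE_laxLeading (p : ℕ) : GradedDegreeLE 2 (laxLeading p) := by
  have h00 : (C (tP p) * X ^ 2).natDegree ≤ 2 := by compute_degree
  have h01 : (X : (R p)[X]).natDegree ≤ 1 := natDegree_X_le
  have h10 : (-(C (tP p ^ 2) * X ^ 3)).natDegree ≤ 3 := by compute_degree
  have h11 : (-(C (tP p) * X ^ 2)).natDegree ≤ 2 := by compute_degree
  intro i j
  fin_cases i <;> fin_cases j
  exacts [h00, Nat.succ_le_succ h01, h10, Nat.succ_le_succ h11]

theorem exists_AM_eq_laxLeading_add (p : ℕ) (c : R p) :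
    ∃ M, GradedDegreeLE 1 M ∧ AM p (C : R p →+* (R p)[X]) (X + C c) = laxLeading p + M := by
  refine ⟨!![C (tP p * (2 * c)) * X + C (A0 p 0 0 + tP p * c ^ 2), C (A0 p 0 1 + c);
    C (A2 p 1 0 - tP p ^ 2 * (3 * c)) * X ^ 2
      + C (hP p + A2 p 1 0 * (2 * c) - tP p ^ 2 * (3 * c ^ 2)) * X
      + C (A0 p 1 0 + hP p * c + A2 p 1 0 * c ^ 2 - tP p ^ 2 * c ^ 3),
    C (-(tP p * (2 * c))) * X + C (A0 p 1 1 - tP p * c ^ 2)], fun i j => ?_, ?_⟩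
  · fin_cases i <;> fin_cases j
    · exact natDegree_linear_le
    · exact Nat.succ_le_succ (natDegree_C _).le
    · exact natDegree_quadratic_le
    · exact Nat.succ_le_succ natDegree_linear_le
  · have h2 : C (2 : R p) = 2 := map_ofNat C 2
    have h3 : C (3 : R p) = 3 := map_ofNat C 3
    ext1 i j
    fin_cases i <;> fin_cases j <;> simp [AM, A1, A2, A3, laxLeading, h2, h3] <;> ring

theorem gradedDegreeLE_AM (p : ℕ) (c : R p) :
    GradedDegreeLE 2 (AM p (C : R p →+* (R p)[X]) (X + C c)) := by
  obtain ⟨M, hM, h⟩ := exists_AM_eq_laxLeading_add p c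
  exact h ▸ (gradedDegreeLE_laxLeading p).add (hM.mono one_le_two)

theorem gradedDegreeLE_AM_mul_AM (p : ℕ) (c d : R p) :
    GradedDegreeLE 3 (AM p (C : R p →+* (R p)[X]) (X + C c) *
      AM p (C : R p →+* (R p)[X]) (X + C d)) := by
  obtain ⟨M, hM, hc⟩ := exists_AM_eq_laxLeading_add p c
  obtain ⟨N, hN, hd⟩ := exists_AM_eq_laxLeading_add p d
  have hL := gradedDegreeLE_laxLeading p
  rw [hc, hd, add_mul, mul_add, mul_add, laxLeading_mul_self, zero_add]
  exact (hL.mul hN).add ((hM.mul hL).add ((hM.mul hN).mono (Nat.le_succ 2)))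

theorem gradedDegreeLE_prod_AM (p n : ℕ) (hn : 2 ≤ n) :
    GradedDegreeLE (2 * n - 1) ((List.range n).reverse.map
      (fun k : ℕ => AM p (C : R p →+* (R p)[X]) (X + (k : (R p)[X])))).prod := by
  induction n, hn using Nat.le_induction with
  | base => simpa [List.range_succ] using gradedDegreeLE_AM_mul_AM p 1 0
  | succ n hn ih =>
    rw [List.range_succ, List.reverse_append, List.map_append, List.prod_append]
    convert (gradedDegreeLE_AM p n).mul ih using 1
    · omega
    · simp

theorem natDegree_chi_le (p : ℕ) (hp : 2 ≤ p) : (chi p).natDegree ≤ 2 * p - 1 :=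
  chi_eq_shiftTrace p ▸ (gradedDegreeLE_prod_AM p p hp).natDegree_trace_le

end Polynomial

/-! ### Translation-invariant polynomials in characteristic `p` -/

namespace Polynomial

theorem eq_zero_of_natDegree_lt_of_eval_natCast_eq_zero {S : Type*} [CommRing S]
    [IsDomain S] (p : ℕ) [CharP S p] (P : S[X])
    (hdeg : P.natDegree < p) (h : ∀ k : ℕ, P.eval (k : S) = 0) : P = 0 := by
  refine eq_zero_of_natDegree_lt_card_of_eval_eq_zero P (ι := Fin p) (f := fun k => (k.val : S))
    ?_ (fun k => h k) (by simpa using hdeg)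
  intro a b hab
  exact Fin.ext (CharP.natCast_injOn_Iio S p a.2 b.2 hab)

theorem eval_natCast_of_comp_X_add_one {S : Type*} [CommRing S] {P : S[X]} (h : P.comp (X + 1) = P) (k : ℕ) :
    P.eval (k : S) = P.eval 0 := by
  induction k with
  | zero => simp
  | succ k ih =>
    rw [← ih]
    conv_rhs => rw [← h]
    simp

theorem exists_eq_of_comp_X_add_one {S : Type*} [CommRing S] [IsDomain S] (p : ℕ)
    (hp : p.Prime) [CharP S p] (P : S[X])
    (h : P.comp (X + 1) = P) (hdeg : P.natDegree < 2 * p) :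
    ∃ a b : S, P = C a + C b * (X ^ p - X) := by
  have : Fact p.Prime := ⟨hp⟩
  have hX : (X ^ p - X : S[X]).natDegree = p := by
    compute_degree!
    · simp [hp.one_lt.ne]
    · exact hp.one_lt.le
  have hmonic : (X ^ p - X : S[X]).Monic :=
    monic_X_pow_sub (by rw [degree_X]; exact_mod_cast hp.one_lt)
  have hfrob (k : ℕ) : (k : S) ^ p = k := by
    have := congrArg (ZMod.castHom dvd_rfl S) (ZMod.pow_card (k : ZMod p))
    rwa [map_pow, map_natCast] at this
  have hcomp : (X ^ p - X : S[X]).comp (X + 1) = X ^ p - X := by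
    simp [add_pow_char]
  have hdiv : P - C (P.eval 0) = (X ^ p - X) * ((P - C (P.eval 0)) /ₘ (X ^ p - X)) := by
    set D := P - C (P.eval 0)
    have hmod : D %ₘ (X ^ p - X) = 0 := by
      refine eq_zero_of_natDegree_lt_of_eval_natCast_eq_zero p _ ?_ fun k => ?_
      · have := natDegree_modByMonic_lt D hmonic
          (fun h1 => by rw [h1, natDegree_one] at hX; exact hp.ne_zero hX.symm)
        rwa [hX] at this
      · have := congrArg (eval (k : S)) (modByMonic_add_div D (X ^ p - X))
        simpa [D, hfrob, eval_natCast_of_comp_X_add_one h] using this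
    have := modByMonic_add_div D (X ^ p - X)
    rw [hmod, zero_add] at this
    exact this.symm
  set Q := (P - C (P.eval 0)) /ₘ (X ^ p - X) with hQ
  have hQcomp : Q.comp (X + 1) = Q := by
    have := congrArg (fun q => q.comp (X + 1)) hdiv
    simp only [sub_comp, C_comp, h, mul_comp] at this
    rw [← sub_comp, hcomp, hdiv] at this
    exact (mul_left_cancel₀ hmonic.ne_zero this).symm
  have hQdeg : Q.natDegree < p := by
    rw [hQ, natDegree_divByMonic _ hmonic, hX, natDegree_sub_C]
    omega
  have hQconst : Q - C (Q.eval 0) = 0 := by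
    refine eq_zero_of_natDegree_lt_of_eval_natCast_eq_zero p _ (by rwa [natDegree_sub_C]) ?_
    intro k
    simp [eval_natCast_of_comp_X_add_one hQcomp]
  refine ⟨P.eval 0, Q.eval 0, ?_⟩
  rw [← sub_eq_zero.mp hQconst]
  linear_combination hdiv

end Polynomial

theorem chi_comp_X_add_one (p : ℕ) : (chi p).comp (Polynomial.X + 1) = chi p := by
  have h := map_shiftTrace p (Polynomial.C : R p →+* Polynomial (R p))
    (Polynomial.compRingHom (Polynomial.X + 1)) Polynomial.X
  have hC : (Polynomial.compRingHom (Polynomial.X + 1)).comp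
      (Polynomial.C : R p →+* Polynomial (R p)) = Polynomial.C := by
    ext <;> simp
  rw [hC, ← chi_eq_shiftTrace] at h
  simp only [Polynomial.coe_compRingHom_apply, Polynomial.X_comp] at h
  rw [h, shiftTrace_add_one, chi_eq_shiftTrace]

theorem coeff_zero_chi (p : ℕ) : (chi p).coeff 0 = Ip p := by
  have h := map_shiftTrace p (Polynomial.C : R p →+* Polynomial (R p))
    (Polynomial.evalRingHom 0) Polynomial.X
  have hC : (Polynomial.evalRingHom 0).comp
      (Polynomial.C : R p →+* Polynomial (R p)) = RingHom.id _ := by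
    ext <;> simp
  rw [hC, ← chi_eq_shiftTrace] at h
  simpa [Polynomial.coeff_zero_eq_eval_zero, Ip_eq_shiftTrace] using h

/-- `χ_p(Z) = i₀ + i₁·Z + i_p·Z^p` with `i₁ + i_p = 0` and `i₀ = I_p`. -/
theorem chi_form (p : ℕ) (hp : p.Prime) :
    (∀ k : ℕ, k ≠ 0 → k ≠ 1 → k ≠ p → (chi p).coeff k = 0) ∧
    (chi p).coeff 1 + (chi p).coeff p = 0 ∧
    (chi p).coeff 0 = Ip p := by
  have : Fact p.Prime := ⟨hp⟩
  obtain ⟨a, b, hab⟩ := Polynomial.exists_eq_of_comp_X_add_one p hp (chi p)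
    (chi_comp_X_add_one p) (by have := Polynomial.natDegree_chi_le p hp.two_le; have := hp.pos; omega)
  refine ⟨fun k h0 h1 hk => ?_, ?_, coeff_zero_chi p⟩
  · rw [hab]
    simp [Polynomial.coeff_C, Polynomial.coeff_X, Polynomial.coeff_X_pow, h0, h1.symm, hk]
  · rw [hab]
    simp [Polynomial.coeff_C, Polynomial.coeff_X, Polynomial.coeff_X_pow, hp.one_lt.ne,
      hp.ne_zero]
end

section
/- Let p be a prime and S a commutative ring of characteristic p. For any 2×2 matrices B₀, B₁, B₂ over S, the following trace identity holds in the polynomial ring S[Z]: Tr[B(Z + p − 1)·B(Z + p − 2)·⋯·B(Z + 1)·B(Z)] = (Z^p − Z)²·Tr(B₂^p) − (Z^p − Z)·Tr(B₂^{p−1}·B₁) + (Z^p − Z)·Tr(B₁^p) + Tr[B(p−1)·B(p−2)·⋯·B(1)·B(0)], where the last trace is a constant polynomial (an element of S). -/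
noncomputable section

/-- The `2×2` matrix polynomial `B(Z) = B₀ + Z·B₁ + Z²·B₂` over `S[Z]`, evaluated at a
polynomial `z ∈ S[Z]` (e.g. `z = Z + k`). -/
def Bpoly {S : Type*} [CommRing S] (B0 B1 B2 : Matrix (Fin 2) (Fin 2) S)
    (z : Polynomial S) : Matrix (Fin 2) (Fin 2) (Polynomial S) :=
  B0.map Polynomial.C + z • B1.map Polynomial.C + z ^ 2 • B2.map Polynomial.C

open Polynomial

/-- If `s` is a finite set of words on which shifting acts freely, and the sum of `F` over each
shift orbit lies in `A`, then so does the sum of `F` over `s`. -/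
theorem sum_mem_of_shift_orbit_sum_mem {G β M σ : Type*} [AddCommGroup G] [Fintype G]
    [DecidableEq (G → β)] [AddCommMonoid M] [SetLike σ M] [AddSubmonoidClass σ M] (A : σ)
    (F : (G → β) → M) (s : Finset (G → β))
    (hshift : ∀ w ∈ s, ∀ g : G, (fun i => w (i + g)) ∈ s)
    (hfree : ∀ w ∈ s, ∀ g : G, (fun i => w (i + g)) = w → g = 0)
    (hF : ∀ w ∈ s, ∑ g : G, F (fun i => w (i + g)) ∈ A) :
    ∑ w ∈ s, F w ∈ A := by
  induction s using Finset.strongInduction with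
  | H s ih =>
    obtain rfl | ⟨w, hw⟩ := s.eq_empty_or_nonempty
    · simp [zero_mem]
    set t : Finset (G → β) := Finset.univ.image fun g : G => fun i => w (i + g) with ht
    have hts : t ⊆ s := by
      intro v hv
      obtain ⟨g, -, rfl⟩ := Finset.mem_image.1 hv
      exact hshift w hw g
    have hwt : w ∈ t := Finset.mem_image.2 ⟨0, Finset.mem_univ _, by simp⟩
    rw [← Finset.sum_sdiff hts]
    refine add_mem (ih _ (Finset.sdiff_ssubset hts ⟨w, hwt⟩) ?_ ?_ ?_) ?_
    · intro v hv g
      rw [Finset.mem_sdiff] at hv ⊢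
      refine ⟨hshift v hv.1 g, fun h => hv.2 ?_⟩
      obtain ⟨k, -, hk⟩ := Finset.mem_image.1 h
      refine Finset.mem_image.2 ⟨k - g, Finset.mem_univ _, funext fun i => ?_⟩
      have := congrFun hk (i - g)
      simp only [sub_add_cancel] at this
      rw [← this]
      congr 1
      abel
    · exact fun v hv => hfree v (Finset.mem_sdiff.1 hv).1
    · exact fun v hv => hF v (Finset.mem_sdiff.1 hv).1
    · rw [ht, Finset.sum_image]
      · exact hF w hw
      · intro g _ h _ hgh
        rw [← sub_eq_zero]
        refine hfree w hw _ (funext fun i => ?_)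
        have := congrFun hgh (i - h)
        simp only [sub_add_cancel] at this
        rw [← this]
        congr 1
        abel

/-- A word over a group of prime order that is fixed by a nontrivial shift is constant. -/
theorem eq_zero_of_shift_eq {p : ℕ} [Fact p.Prime] {β : Type*} {w : ZMod p → β}
    (hw : ¬ ∃ b, w = fun _ => b) {g : ZMod p} (hg : (fun i => w (i + g)) = w) : g = 0 := by
  by_contra hg0
  have key : ∀ k : ℕ, w (k * g) = w 0 := by
    intro k
    induction k with
    | zero => simp
    | succ k ih =>
      rw [← ih, Nat.cast_succ, add_mul, one_mul]
      exact congrFun hg _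
  refine hw ⟨w 0, funext fun i => ?_⟩
  have := key (i / g).val
  rwa [ZMod.natCast_zmod_val, div_mul_cancel₀ _ hg0] at this

theorem prod_X_sub_C_zmod (p : ℕ) [Fact p.Prime] :
    ∏ a : ZMod p, (X - C a) = X ^ p - X := by
  have hp := (Fact.out : p.Prime).one_lt
  have hroots : (X ^ p - X : (ZMod p)[X]).roots = Finset.univ.val := by
    simpa [ZMod.card] using FiniteField.roots_X_pow_card_sub_X (ZMod p)
  have := prod_multiset_X_sub_C_of_monic_of_roots_card_eq
    (p := (X ^ p - X : (ZMod p)[X])) (monic_X_pow_sub (by simpa using hp))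
    (by rw [hroots, FiniteField.X_pow_card_sub_X_natDegree_eq _ hp]; simp [ZMod.card])
  rw [hroots] at this
  exact this

theorem sum_zmod_pow_eq_zero {p : ℕ} [Fact p.Prime] {m : ℕ} (hm : m < 2 * (p - 1))
    (hmp : m ≠ p - 1) : ∑ a : ZMod p, a ^ m = 0 := by
  have hp := (Fact.out : p.Prime).two_le
  obtain h | h := lt_or_gt_of_ne hmp
  · exact FiniteField.sum_pow_lt_card_sub_one _ m (by rwa [ZMod.card])
  · rw [← FiniteField.sum_pow_lt_card_sub_one (ZMod p) (m - (p - 1)) (by rw [ZMod.card]; omega)]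
    refine Finset.sum_congr rfl fun a _ => ?_
    obtain rfl | ha := eq_or_ne a 0
    · rw [zero_pow (by omega), zero_pow (by omega)]
    · conv_lhs => rw [← Nat.sub_add_cancel h.le, pow_add, ZMod.pow_card_sub_one_eq_one ha, mul_one]

theorem sum_X_add_C_zmod_pow {p : ℕ} [Fact p.Prime] {n : ℕ} (hn : n ≤ 2 * (p - 1)) :
    ∑ a : ZMod p, (X + C a) ^ n = C (∑ a : ZMod p, a ^ n) := by
  have hp := (Fact.out : p.Prime).two_le
  ext k
  rw [finsetSum_coeff, coeff_C]
  simp_rw [coeff_X_add_C_pow]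
  rw [← Finset.sum_mul]
  split_ifs with hk
  · simp [hk]
  obtain hnk | hnk := lt_or_ge n k
  · simp [Nat.choose_eq_zero_of_lt hnk]
  by_cases h : n - k = p - 1
  · have hdvd : p ∣ n.choose k := by
      have := Nat.Prime.dvd_choose_add (a := k) (b := n - k) (Fact.out : p.Prime)
        (by omega) (by omega) (by omega)
      rwa [Nat.add_sub_cancel' hnk] at this
    rw [(ZMod.natCast_eq_zero_iff _ _).2 hdvd, mul_zero]
  · rw [sum_zmod_pow_eq_zero (by omega) h, zero_mul]

theorem sum_comp_X_add_C_mem_range_C {p : ℕ} [Fact p.Prime] {S : Type*} [CommRing S]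
    (φ : ZMod p →+* S) {Q : S[X]} (hQ : Q.natDegree ≤ 2 * (p - 1)) :
    ∑ a : ZMod p, Q.comp (X + C (φ a)) ∈ (C : S →+* S[X]).range := by
  have hpow : ∀ n ≤ 2 * (p - 1),
      ∑ a : ZMod p, (X + C (φ a)) ^ n = C (φ (∑ a : ZMod p, a ^ n)) := by
    intro n hn
    have := congrArg (Polynomial.map φ) (sum_X_add_C_zmod_pow hn)
    simpa [Polynomial.map_sum] using this
  simp_rw [comp, eval₂_eq_sum_range]
  rw [Finset.sum_comm]
  refine sum_mem fun n hn => ?_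
  rw [← Finset.mul_sum, hpow n (by rw [Finset.mem_range] at hn; omega), ← C_mul]
  exact ⟨_, rfl⟩

section Word

variable {R β ι : Type*} [CommRing R] [Fintype ι] [DecidableEq ι] {n : ℕ}

/-- The trace of the product of the matrices spelled by a word. -/
def wordTrace (B : β → Matrix ι ι R) (w : Fin n → β) : R :=
  Matrix.trace (List.ofFn fun i => B (w i)).prod

theorem wordTrace_map {R' : Type*} [CommRing R'] (f : R →+* R') (B : β → Matrix ι ι R)
    (w : Fin n → β) : wordTrace (fun b => (B b).map f) w = f (wordTrace B w) := by
  rw [wordTrace, wordTrace, AddMonoidHom.map_trace, ← RingHom.mapMatrix_apply, map_list_prod,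
    List.map_ofFn]
  rfl

theorem wordTrace_shift (B : β → Matrix ι ι R) (w : Fin (n + 1) → β) (g : Fin (n + 1)) :
    wordTrace B (fun i => w (i + g)) = wordTrace B w := by
  have one : ∀ v : Fin (n + 1) → β, wordTrace B (fun i => v (i + 1)) = wordTrace B v := by
    intro v
    rw [wordTrace, wordTrace, List.ofFn_succ', List.ofFn_succ, List.concat_eq_append,
      List.prod_append, List.prod_cons, Matrix.trace_mul_comm]
    simp
  induction g using Fin.induction with
  | zero => simp
  | succ k ih =>
    rw [← ih, ← one fun i => w (i + k.castSucc), ← Fin.coeSucc_eq_succ]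
    exact congrArg (wordTrace B) (funext fun i => congrArg w (by abel))

theorem wordTrace_const (B : β → Matrix ι ι R) (b : β) :
    wordTrace B (fun _ : Fin n => b) = Matrix.trace (B b ^ n) := by
  simp [wordTrace, List.ofFn_const]

theorem wordTrace_update_const (B : β → Matrix ι ι R) (b c : β)
    (k : Fin (n + 1)) :
    wordTrace B (Function.update (fun _ => b) k c) = Matrix.trace (B b ^ n * B c) := by
  rw [← wordTrace_shift B _ k, wordTrace, List.ofFn_succ, List.prod_cons, Matrix.trace_mul_comm]
  congr 2
  · simp [List.ofFn_const]
  · simp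

theorem trace_prod_ofFn_sum_smul [Fintype β] (c : Fin n → β → R) (B : β → Matrix ι ι R) :
    Matrix.trace (List.ofFn fun i => ∑ b, c i b • B b).prod
      = ∑ w : Fin n → β, (∏ i, c i (w i)) * wordTrace B w := by
  have h := (MultilinearMap.mkPiAlgebraFin R n (Matrix ι ι R)).map_sum fun i b => c i b • B b
  rw [MultilinearMap.mkPiAlgebraFin_apply] at h
  rw [h, Matrix.trace_sum]
  refine Finset.sum_congr rfl fun w _ => ?_
  rw [(MultilinearMap.mkPiAlgebraFin R n (Matrix ι ι R)).map_smul_univ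
    (fun i => c i (w i)) fun i => B (w i), Matrix.trace_smul, MultilinearMap.mkPiAlgebraFin_apply]
  rfl

end Word

theorem prod_X_sub_C_map_add_one {p : ℕ} [Fact p.Prime] {S : Type*} [CommRing S]
    (φ : ZMod p →+* S) : ∏ i : ZMod p, (X - C (φ (i + 1))) = X ^ p - X := by
  have := congrArg (Polynomial.map φ) (prod_X_sub_C_zmod p)
  simp only [Polynomial.map_prod, Polynomial.map_sub, map_X, map_C, Polynomial.map_pow] at this
  rw [← this]
  exact Fintype.prod_equiv (Equiv.addRight 1) _ _ fun i => rfl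

/-- The polynomial `∏ i, (X - (i + 1)) ^ w i` attached to a word `w`. -/
noncomputable def wordPoly {p : ℕ} [NeZero p] {S : Type*} [CommRing S] (φ : ZMod p →+* S) (w : ZMod p → Fin 3) :
    S[X] :=
  ∏ i : ZMod p, (X - C (φ (i + 1))) ^ (w i : ℕ)

section WordPoly

variable {p : ℕ} [Fact p.Prime] {S : Type*} [CommRing S] (φ : ZMod p →+* S)

theorem wordPoly_shift (w : ZMod p → Fin 3) (g : ZMod p) :
    wordPoly φ (fun i => w (i + g)) = (wordPoly φ w).comp (X + C (φ g)) := by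
  rw [wordPoly, wordPoly, prod_comp]
  refine Fintype.prod_equiv (Equiv.addRight g) _ _ fun i => ?_
  simp only [Equiv.coe_addRight, pow_comp, sub_comp, X_comp, C_comp]
  simp only [map_add]
  congr 1
  ring

theorem natDegree_wordPoly_le (w : ZMod p → Fin 3) :
    (wordPoly φ w).natDegree ≤ ∑ i, (w i : ℕ) := by
  refine (natDegree_prod_le _ _).trans (Finset.sum_le_sum fun i _ => ?_)
  exact (natDegree_pow_le_of_le _ (natDegree_X_sub_C_le _)).trans (by simp)

theorem wordPoly_const (b : Fin 3) : wordPoly φ (fun _ => b) = (X ^ p - X) ^ (b : ℕ) := by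
  rw [wordPoly, Finset.prod_pow, prod_X_sub_C_map_add_one]

theorem sum_wordPoly_update :
    ∑ k : ZMod p, wordPoly φ (Function.update (fun _ => 2) k 1) = -(X ^ p - X) := by
  have hfactor : ∀ k : ZMod p, wordPoly φ (Function.update (fun _ => 2) k 1)
      = (X ^ p - X) * ∏ i ∈ Finset.univ.erase k, (X - C (φ (i + 1))) := by
    intro k
    rw [← prod_X_sub_C_map_add_one φ, wordPoly,
      ← Finset.mul_prod_erase _ _ (Finset.mem_univ k),
      ← Finset.mul_prod_erase _ (fun i => X - C (φ (i + 1))) (Finset.mem_univ k), mul_assoc,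
      ← Finset.prod_mul_distrib]
    congr 1
    · simp
    · refine Finset.prod_congr rfl fun i hi => ?_
      rw [Function.update_of_ne (Finset.ne_of_mem_erase hi)]
      exact sq _
  have hchar : (p : S[X]) = 0 := by
    rw [← map_natCast (C.comp φ), ZMod.natCast_self, map_zero]
  have hderiv := congrArg derivative (prod_X_sub_C_map_add_one φ)
  rw [derivative_prod_finset] at hderiv
  simp only [derivative_sub, derivative_X, derivative_C, sub_zero, mul_one, derivative_X_pow,
    map_natCast, hchar, zero_mul, zero_sub] at hderiv
  rw [Finset.sum_congr rfl fun k _ => hfactor k, ← Finset.mul_sum, hderiv, mul_neg_one]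

end WordPoly

/-- A word in the letters `0, 1, 2` whose letters sum to more than `2 * (|G| - 1)` is either
constant or has a single letter `1` among letters `2`. -/
theorem exists_eq_update_of_lt_sum {G : Type*} [Fintype G] [DecidableEq G] {w : G → Fin 3}
    (hw : ¬ ∃ b, w = fun _ => b) (hsum : 2 * (Fintype.card G - 1) < ∑ i, (w i : ℕ)) :
    ∃ k, w = Function.update (fun _ => 2) k 1 := by
  obtain ⟨k, hk⟩ : ∃ k, w k ≠ 2 := by
    by_contra! h
    exact hw ⟨2, funext h⟩
  have hrest : ∀ j ≠ k, w k + w j + 2 * (Fintype.card G - 2) ≥ ∑ i, (w i : ℕ) := by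
    intro j hj
    rw [← Finset.add_sum_erase _ _ (Finset.mem_univ k),
      ← Finset.add_sum_erase _ _ (Finset.mem_erase.2 ⟨hj, Finset.mem_univ j⟩), ← add_assoc]
    gcongr
    refine (Finset.sum_le_card_nsmul _ _ 2 fun i _ => by omega).trans ?_
    rw [Finset.card_erase_of_mem (by simp [hj]), Finset.card_erase_of_mem (by simp),
      Finset.card_univ, smul_eq_mul]
    omega
  have hrest' : w k + 2 * (Fintype.card G - 1) ≥ ∑ i, (w i : ℕ) := by
    rw [← Finset.add_sum_erase _ _ (Finset.mem_univ k)]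
    gcongr
    refine (Finset.sum_le_card_nsmul _ _ 2 fun i _ => by omega).trans ?_
    rw [Finset.card_erase_of_mem (by simp), Finset.card_univ, smul_eq_mul]
    omega
  refine ⟨k, funext fun j => ?_⟩
  obtain rfl | hj := eq_or_ne j k
  · rw [Function.update_self]
    omega
  · have := hrest j hj
    have : 1 < Fintype.card G := Fintype.one_lt_card_iff.2 ⟨j, k, hj⟩
    rw [Function.update_of_ne hj]
    omega

/-- Modulo constants, the only words contributing to the trace of the cyclic product are `2 ⋯ 2`,
`1 ⋯ 1`, and the shifts of `2 ⋯ 2 1`. -/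
theorem sum_wordPoly_mul_wordTrace_sub_mem_range_C {n : ℕ} [Fact (n + 1).Prime] {S : Type*}
    [CommRing S] {ι : Type*} [Fintype ι] [DecidableEq ι] (φ : ZMod (n + 1) →+* S)
    (B : Fin 3 → Matrix ι ι S) :
    ∑ w : ZMod (n + 1) → Fin 3, wordPoly φ w * C (wordTrace (n := n + 1) B w)
      - ((X ^ (n + 1) - X) ^ 2 * C (Matrix.trace (B 2 ^ (n + 1)))
        - (X ^ (n + 1) - X) * C (Matrix.trace (B 2 ^ n * B 1))
        + (X ^ (n + 1) - X) * C (Matrix.trace (B 1 ^ (n + 1)))) ∈ (C : S →+* S[X]).range := by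
  classical
  set F : (ZMod (n + 1) → Fin 3) → S[X] :=
    fun w => wordPoly φ w * C (wordTrace (n := n + 1) B w) with hF
  set generic : Finset (ZMod (n + 1) → Fin 3) := Finset.univ.filter fun w =>
    (¬ ∃ b, w = fun _ => b) ∧ ∑ i, (w i : ℕ) ≤ 2 * n with hgeneric
  set single : ZMod (n + 1) → ZMod (n + 1) → Fin 3 := fun k => Function.update (fun _ => 2) k 1
    with hsingle
  have hsingle_inj : Function.Injective single := by
    intro k l h
    by_contra hkl
    have := congrFun h k
    simp [hsingle, Function.update_of_ne hkl] at this
  have hsingle_nonconst : ∀ k, ¬ ∃ b, single k = fun _ => b := by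
    rintro k ⟨b, hb⟩
    have h1 := congrFun hb k
    have h2 := congrFun hb (k + 1)
    simp only [hsingle, Function.update_self] at h1
    simp only [hsingle] at h2
    rw [Function.update_of_ne (by simp), ← h1] at h2
    exact absurd h2 (by decide)
  have hsum_single : ∀ k, ∑ i, (single k i : ℕ) = 2 * n + 1 := by
    intro k
    rw [← Finset.add_sum_erase _ _ (Finset.mem_univ k), Finset.sum_congr rfl (g := fun _ => 2)]
    · simp [hsingle, ZMod.card]
      ring
    · intro i hi
      simp [hsingle, Function.update_of_ne (Finset.ne_of_mem_erase hi)]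
  have hcompl : genericᶜ
      = Finset.univ.image (fun b _ => b) ∪ Finset.univ.image single := by
    ext w
    simp only [hgeneric, Finset.mem_compl, Finset.mem_filter, Finset.mem_univ, true_and,
      Finset.mem_union, Finset.mem_image]
    constructor
    · intro h
      by_cases hw : ∃ b, w = fun _ => b
      · exact Or.inl (hw.imp fun b hb => hb.symm)
      · obtain ⟨k, hk⟩ := exists_eq_update_of_lt_sum hw (by
          rw [ZMod.card]
          by_contra hle
          exact h ⟨hw, by simpa using hle⟩)
        exact Or.inr ⟨k, hk.symm⟩
    · rintro (⟨b, rfl⟩ | ⟨k, rfl⟩) ⟨h1, h2⟩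
      · exact h1 ⟨b, rfl⟩
      · rw [hsum_single] at h2
        omega
  have hdisj : Disjoint (Finset.univ.image fun (b : Fin 3) (_ : ZMod (n + 1)) => b)
      (Finset.univ.image single) := by
    rw [Finset.disjoint_left]
    intro w h1 h2
    obtain ⟨b, -, rfl⟩ := Finset.mem_image.1 h1
    obtain ⟨k, -, hk⟩ := Finset.mem_image.1 h2
    exact hsingle_nonconst k ⟨b, hk⟩
  have hconst_sum : ∑ w ∈ Finset.univ.image (fun (b : Fin 3) (_ : ZMod (n + 1)) => b), F w
      = C (Matrix.trace (B 0 ^ (n + 1)))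
        + (X ^ (n + 1) - X) * C (Matrix.trace (B 1 ^ (n + 1)))
        + (X ^ (n + 1) - X) ^ 2 * C (Matrix.trace (B 2 ^ (n + 1))) := by
    have htrace : ∀ b, wordTrace (n := n + 1) B (fun _ : ZMod (n + 1) => b)
        = Matrix.trace (B b ^ (n + 1)) := wordTrace_const B
    rw [Finset.sum_image fun b _ c _ h => congrFun h 0, Fin.sum_univ_three]
    simp only [hF, htrace, wordPoly_const]
    simp
  have hsingle_sum : ∑ w ∈ Finset.univ.image single, F w
      = -((X ^ (n + 1) - X) * C (Matrix.trace (B 2 ^ n * B 1))) := by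
    have htrace : ∀ k, wordTrace (n := n + 1) B (single k) = Matrix.trace (B 2 ^ n * B 1) :=
      wordTrace_update_const B 2 1
    rw [Finset.sum_image hsingle_inj.injOn]
    simp only [hF, htrace]
    rw [← Finset.sum_mul, sum_wordPoly_update, neg_mul]
  have hgeneric_sum : ∑ w ∈ generic, F w ∈ (C : S →+* S[X]).range := by
    refine sum_mem_of_shift_orbit_sum_mem _ F generic ?_ ?_ ?_
    · intro w hw g
      simp only [hgeneric, Finset.mem_filter, Finset.mem_univ, true_and] at hw ⊢
      refine ⟨fun ⟨b, hb⟩ => hw.1 ⟨b, funext fun i => ?_⟩, ?_⟩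
      · simpa using congrFun hb (i - g)
      · rw [← Equiv.sum_comp (Equiv.addRight g)] at hw
        exact hw.2
    · intro w hw g
      exact eq_zero_of_shift_eq (Finset.mem_filter.1 hw).2.1
    · intro w hw
      have htrace : ∀ g : ZMod (n + 1), wordTrace (n := n + 1) B (fun i : ZMod (n + 1) => w (i + g))
          = wordTrace (n := n + 1) B w := wordTrace_shift B w
      simp only [hF, htrace, wordPoly_shift]
      rw [← Finset.sum_mul]
      refine mul_mem (sum_comp_X_add_C_mem_range_C φ ?_) ⟨_, rfl⟩
      exact (natDegree_wordPoly_le φ w).trans (Finset.mem_filter.1 hw).2.2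
  rw [← Finset.sum_add_sum_compl generic, hcompl, Finset.sum_union hdisj, hconst_sum, hsingle_sum]
  convert! add_mem hgeneric_sum (⟨Matrix.trace (B 0 ^ (n + 1)), rfl⟩ :
    C (Matrix.trace (B 0 ^ (n + 1))) ∈ (C : S →+* S[X]).range) using 1
  ring

/-- The descending cyclic product, expanded into words. -/
theorem trace_prod_Bpoly {n : ℕ} {S : Type*} [CommRing S] [CharP S (n + 1)]
    (B0 B1 B2 : Matrix (Fin 2) (Fin 2) S) :
    Matrix.trace (((List.range (n + 1)).reverse.map
        (fun (k : ℕ) => Bpoly B0 B1 B2 (X + C ((k : S))))).prod)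
      = ∑ w : ZMod (n + 1) → Fin 3, wordPoly (ZMod.castHom dvd_rfl S) w
        * C (wordTrace (n := n + 1) ![B0, B1, B2] w) := by
  have hlist : (List.range (n + 1)).reverse.map
        (fun (k : ℕ) => Bpoly B0 B1 B2 (X + C ((k : S))))
      = List.ofFn fun i : Fin (n + 1) => ∑ b : Fin 3,
        (X - C (ZMod.castHom (dvd_refl (n + 1)) S (((i : ℕ) : ZMod (n + 1)) + 1))) ^ (b : ℕ)
          • (![B0, B1, B2] b).map C := by
    refine List.ext_getElem (by simp) fun i h1 h2 => ?_
    have hi : i ≤ n := by simpa [Nat.lt_succ_iff] using h1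
    have hcast : X - C (ZMod.castHom (dvd_refl (n + 1)) S ((i : ZMod (n + 1)) + 1))
        = X + C ((n - i : ℕ) : S) := by
      rw [map_add, map_natCast, map_one, sub_eq_add_neg, ← C_neg,
        Nat.cast_sub hi]
      have := CharP.cast_eq_zero S (n + 1)
      rw [Nat.cast_add_one] at this
      congr 2
      linear_combination -this
    simp only [List.getElem_map, List.getElem_reverse, List.getElem_range, List.length_range,
      List.getElem_ofFn, Fin.sum_univ_three, hcast, Bpoly]
    simp
  rw [hlist, trace_prod_ofFn_sum_smul]
  refine Finset.sum_congr rfl fun w _ => ?_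
  rw [wordTrace_map]
  refine congrArg (· * _) (Finset.prod_congr rfl fun i _ => ?_)
  exact congrArg (fun a => (X - C (ZMod.castHom (dvd_refl (n + 1)) S (a + 1))) ^ (w i : ℕ))
    (ZMod.natCast_zmod_val (n := n + 1) i)

/-- Lemma on traces of cyclic products. For any commutative ring `S` of
characteristic `p` and `2×2` matrices `B₀, B₁, B₂` over `S`,
`Tr[B(Z+p−1)⋯B(Z)] = (Z^p−Z)²·Tr(B₂^p) − (Z^p−Z)·Tr(B₂^{p−1}B₁) + (Z^p−Z)·Tr(B₁^p)
  + Tr[B(p−1)⋯B(0)]` in `S[Z]`. -/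
theorem trace_cyclic_product (p : ℕ) (hp : p.Prime) (S : Type*) [CommRing S] [CharP S p]
    (B0 B1 B2 : Matrix (Fin 2) (Fin 2) S) :
    Matrix.trace (((List.range p).reverse.map
        (fun (k : ℕ) => Bpoly B0 B1 B2 (Polynomial.X + Polynomial.C ((k : S))))).prod)
    = (Polynomial.X ^ p - Polynomial.X) ^ 2 * Polynomial.C (Matrix.trace (B2 ^ p))
      - (Polynomial.X ^ p - Polynomial.X) * Polynomial.C (Matrix.trace (B2 ^ (p - 1) * B1))
      + (Polynomial.X ^ p - Polynomial.X) * Polynomial.C (Matrix.trace (B1 ^ p))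
      + Polynomial.C (Matrix.trace (((List.range p).reverse.map
          (fun (k : ℕ) => B0 + ((k : S)) • B1 + ((k : S)) ^ 2 • B2)).prod)) := by
  have : Fact p.Prime := ⟨hp⟩
  obtain ⟨n, rfl⟩ := Nat.exists_eq_succ_of_ne_zero hp.ne_zero
  obtain ⟨c, hc⟩ := sum_wordPoly_mul_wordTrace_sub_mem_range_C
    (ZMod.castHom (dvd_refl (n + 1)) S) ![B0, B1, B2]
  rw [← trace_prod_Bpoly, eq_sub_iff_add_eq'] at hc
  have hconst : c = Matrix.trace (((List.range (n + 1)).reverse.map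
      (fun (k : ℕ) => B0 + ((k : S)) • B1 + ((k : S)) ^ 2 • B2)).prod) := by
    have hleft : c = evalRingHom 0 (Matrix.trace (((List.range (n + 1)).reverse.map
        (fun (k : ℕ) => Bpoly B0 B1 B2 (X + C ((k : S))))).prod)) := by
      rw [← hc]
      simp
    rw [hleft, AddMonoidHom.map_trace, ← RingHom.mapMatrix_apply, map_list_prod, List.map_map]
    congr 3
    funext k
    ext i j
    simp [Bpoly]
  rw [← hconst]
  exact hc.symm

end
end

section
/- Let p be an odd prime. Then χ_p(Z) = C(I_p) − C(t^p)·Z + C(t^p)·Z^p in R[Z], where C : R → R[Z] is the constant-polynomial embedding; that is, the coefficient of Z⁰ in χ_p is I_p, the coefficient of Z¹ is −t^p, the coefficient of Z^p is t^p, and all other coefficients vanish. -/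
open MvPolynomial

namespace Polynomial.LaxTrace

/-- The ordered product `F (n - 1) * ⋯ * F 1 * F 0`. -/
def descProd {M : Type*} [Monoid M] (F : ℕ → M) (n : ℕ) : M :=
  ((List.range n).reverse.map F).prod

section DescProd

variable {M : Type*} [Monoid M] (F : ℕ → M)

@[simp] theorem descProd_zero : descProd F 0 = 1 := by simp [descProd]

theorem descProd_succ (n : ℕ) : descProd F (n + 1) = F n * descProd F n := by
  simp [descProd, List.range_succ]

theorem descProd_add (a b : ℕ) :
    descProd F (a + b) = descProd (fun k => F (k + a)) b * descProd F a := by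
  induction b with
  | zero => simp
  | succ b ih => rw [← add_assoc, descProd_succ, ih, descProd_succ, mul_assoc, add_comm a b]

theorem map_descProd {N : Type*} [Monoid N] (φ : M →* N) (n : ℕ) :
    φ (descProd F n) = descProd (fun k => φ (F k)) n := by
  simp [descProd, map_list_prod, Function.comp_def]

end DescProd

/-- A `2 × 2` polynomial matrix has weight at most `n` when its `(i, j)` entry has degree at most
`(n + i - j) / 2`, that is, when conjugating by `diag(1, √X)` makes every entry `O(X ^ (n / 2))`. -/
def HasWeight {S : Type*} [CommRing S] (n : ℕ) (M : Matrix (Fin 2) (Fin 2) S[X]) : Prop :=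
  ∀ (i j : Fin 2) (k : ℕ), n + (i : ℕ) < 2 * k + (j : ℕ) → (M i j).coeff k = 0

section Weight

variable {S : Type*} [CommRing S]

theorem HasWeight.mul {m n : ℕ} {M N : Matrix (Fin 2) (Fin 2) S[X]}
    (hM : HasWeight m M) (hN : HasWeight n N) : HasWeight (m + n) (M * N) := by
  intro i j k hk
  rw [Matrix.mul_apply, finsetSum_coeff]
  refine Finset.sum_eq_zero fun l _ => ?_
  rw [coeff_mul]
  refine Finset.sum_eq_zero fun ab hab => ?_
  rw [Finset.HasAntidiagonal.mem_antidiagonal] at hab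
  by_cases h : m + (i : ℕ) < 2 * ab.1 + (l : ℕ)
  · rw [hM _ _ _ h, zero_mul]
  · rw [hN l j ab.2 (by omega), mul_zero]

theorem HasWeight.sum {ι : Type*} {s : Finset ι} {n : ℕ} {M : ι → Matrix (Fin 2) (Fin 2) S[X]}
    (h : ∀ x ∈ s, HasWeight n (M x)) : HasWeight n (∑ x ∈ s, M x) := by
  intro i j k hk
  rw [Matrix.sum_apply, finsetSum_coeff]
  exact Finset.sum_eq_zero fun x hx => h x hx i j k hk

theorem hasWeight_zero (n : ℕ) : HasWeight n (0 : Matrix (Fin 2) (Fin 2) S[X]) := by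
  intro i j k _
  simp

theorem hasWeight_one : HasWeight 0 (1 : Matrix (Fin 2) (Fin 2) S[X]) := by
  intro i j k hk
  rw [Matrix.one_apply]
  split_ifs with h
  · subst h
    rw [coeff_one, if_neg (by omega)]
  · simp

theorem HasWeight.mono {m n : ℕ} (hmn : m ≤ n) {M : Matrix (Fin 2) (Fin 2) S[X]}
    (hM : HasWeight m M) : HasWeight n M :=
  fun i j k hk => hM i j k (by omega)

/-- Translation `X ↦ X + r` never raises the weight. -/
theorem HasWeight.taylor {n : ℕ} {M : Matrix (Fin 2) (Fin 2) S[X]} (hM : HasWeight n M) (r : S) :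
    HasWeight n ((taylorAlgHom r).mapMatrix M) := by
  intro i j k hk
  have : hasseDeriv k (M i j) = 0 := by
    ext l
    rw [hasseDeriv_coeff, hM i j (l + k) (by omega), mul_zero, coeff_zero]
  simp [taylor_coeff, this]

theorem HasWeight.coeff_mul {m n : ℕ} {P Q : (Matrix (Fin 2) (Fin 2) S[X])[X]}
    (hP : ∀ l, HasWeight m (P.coeff l)) (hQ : ∀ l, HasWeight n (Q.coeff l)) (l : ℕ) :
    HasWeight (m + n) ((P * Q).coeff l) := by
  rw [Polynomial.coeff_mul]
  exact HasWeight.sum fun x _ => (hP _).mul (hQ _)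

theorem HasWeight.coeff_descProd {m : ℕ} {F : ℕ → (Matrix (Fin 2) (Fin 2) S[X])[X]}
    (hF : ∀ k l, HasWeight m ((F k).coeff l)) (n l : ℕ) :
    HasWeight (n * m) ((descProd F n).coeff l) := by
  induction n generalizing l with
  | zero =>
    rw [descProd_zero, coeff_one, zero_mul]
    split_ifs
    exacts [hasWeight_one, hasWeight_zero 0]
  | succ n ih =>
    rw [descProd_succ, show (n + 1) * m = m + n * m by ring]
    exact HasWeight.coeff_mul (hF n) ih l

end Weight

/-- A polynomial of degree less than `p` that is invariant under `X ↦ X + 1` is constant. -/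
theorem eq_C_of_taylor_one_eq {S : Type*} [CommRing S] [IsDomain S] (p : ℕ) [CharP S p] {q : S[X]} (hq : q.natDegree < p)
    (h : taylor 1 q = q) : q = C (q.eval 0) := by
  have hval : ∀ j : ℕ, q.eval (j : S) = q.eval 0 := by
    intro j
    induction j with
    | zero => simp
    | succ j ih =>
      have := congrArg (eval (j : S)) h
      rw [taylor_eval, ih] at this
      simpa using this
  have hinj : Function.Injective fun j : Fin p => ((j : ℕ) : S) := by
    intro a b hab
    have := (CharP.natCast_eq_natCast S p).1 hab
    exact Fin.ext (Nat.ModEq.eq_of_lt_of_lt this a.2 b.2)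
  refine sub_eq_zero.1 (eq_zero_of_natDegree_lt_card_of_eval_eq_zero _ hinj (fun j => ?_) ?_)
  · simp [hval]
  · simpa using hq

section PowerSums

variable {S : Type*} [CommRing S] (p : ℕ) [Fact p.Prime] [CharP S p]

theorem sum_range_natCast_pow_eq_zero {e : ℕ} (he : e < p - 1) :
    ∑ j ∈ Finset.range p, (j : S) ^ e = 0 := by
  have h := FiniteField.sum_pow_lt_card_sub_one (ZMod p) e (by rwa [ZMod.card])
  have h' : ∑ j ∈ Finset.range p, ((j : ZMod p)) ^ e = 0 := by
    rw [← h]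
    refine Finset.sum_bij' (fun j _ => (j : ZMod p)) (fun x _ => x.val) ?_ ?_ ?_ ?_ ?_
    · simp
    · exact fun x _ => Finset.mem_range.2 x.val_lt
    · exact fun j hj => ZMod.val_cast_of_lt (Finset.mem_range.1 hj)
    · exact fun x _ => ZMod.natCast_zmod_val x
    · simp
  simpa using congrArg (ZMod.castHom dvd_rfl S) h'

theorem sum_range_eval_eq_zero {q : S[X]} (hq : q.natDegree < p - 1) :
    ∑ j ∈ Finset.range p, q.eval (j : S) = 0 := by
  simp_rw [eval_eq_sum_range]
  rw [Finset.sum_comm]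
  refine Finset.sum_eq_zero fun e he => ?_
  rw [← Finset.mul_sum, sum_range_natCast_pow_eq_zero p, mul_zero]
  rw [Finset.mem_range] at he
  omega

theorem coeff_sum_taylor_eq_zero {q : S[X]} (hq : q.natDegree < 2 * p - 1) {i : ℕ} (hi : p ≤ i) :
    (∑ j ∈ Finset.range p, taylor (j : S) q).coeff i = 0 := by
  simp_rw [finsetSum_coeff, taylor_coeff]
  apply sum_range_eval_eq_zero p
  have h2 := (Fact.out : p.Prime).two_le
  refine (natDegree_hasseDeriv_le q i).trans_lt ?_
  omega

end PowerSums

section Additivity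

variable {S : Type*} [CommRing S]

theorem trace_coeff_mul_comm (P Q : (Matrix (Fin 2) (Fin 2) S[X])[X]) (m : ℕ) :
    ((P * Q).coeff m).trace = ((Q * P).coeff m).trace := by
  rw [Polynomial.coeff_mul, Polynomial.coeff_mul, Matrix.trace_sum, Matrix.trace_sum,
    ← Finset.Nat.sum_antidiagonal_swap]
  exact Finset.sum_congr rfl fun x _ => Matrix.trace_mul_comm _ _

theorem derivative_descProd {M : Type*} [Ring M] (F : ℕ → M[X]) (n : ℕ) :
    derivative (descProd F n) = ∑ j ∈ Finset.range n,
      descProd (fun k => F (k + (j + 1))) (n - 1 - j) * (derivative (F j) * descProd F j) := by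
  induction n with
  | zero => simp
  | succ n ih =>
    rw [descProd_succ, derivative_mul, ih, Finset.sum_range_succ, Finset.mul_sum, add_comm]
    congr 1
    · refine Finset.sum_congr rfl fun j hj => ?_
      rw [Finset.mem_range] at hj
      rw [← mul_assoc, show n + 1 - 1 - j = (n - 1 - j) + 1 by omega, descProd_succ,
        show n - 1 - j + (j + 1) = n by omega]
    · simp

/-- The translate of a polynomial matrix by `k`. -/
noncomputable def shift (k : ℕ) (M : Matrix (Fin 2) (Fin 2) S[X]) : Matrix (Fin 2) (Fin 2) S[X] :=
  (taylorAlgHom (k : S)).mapMatrix M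

/-- The trace of `M(X + p - 1) ⋯ M(X + 1) M(X)`. -/
noncomputable def cyclicTrace (p : ℕ) (M : Matrix (Fin 2) (Fin 2) S[X]) : S[X] :=
  (descProd (fun k => shift k M) p).trace

theorem shift_shift (k l : ℕ) (M : Matrix (Fin 2) (Fin 2) S[X]) :
    shift k (shift l M) = shift (l + k) M := by
  ext i j : 1
  simp [shift, taylor_taylor, add_comm (k : S)]

theorem shift_add (k : ℕ) (M N : Matrix (Fin 2) (Fin 2) S[X]) :
    shift k (M + N) = shift k M + shift k N :=
  map_add _ M N

theorem shift_mul (k : ℕ) (M N : Matrix (Fin 2) (Fin 2) S[X]) :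
    shift k (M * N) = shift k M * shift k N :=
  map_mul _ M N

theorem shift_zero (M : Matrix (Fin 2) (Fin 2) S[X]) : shift 0 M = M := by
  ext i j : 1
  simp [shift]

theorem shift_char (p : ℕ) [CharP S p] (k : ℕ) (M : Matrix (Fin 2) (Fin 2) S[X]) :
    shift (k + p) M = shift k M := by
  simp [shift]

theorem trace_shift (k : ℕ) (M : Matrix (Fin 2) (Fin 2) S[X]) :
    (shift k M).trace = taylor (k : S) M.trace := by
  simp [shift, Matrix.trace_fin_two]

/-- The `k`-th factor of the pencil interpolating between two polynomial matrices. -/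
noncomputable def pencil (B D : Matrix (Fin 2) (Fin 2) S[X]) (k : ℕ) : (Matrix (Fin 2) (Fin 2) S[X])[X] :=
  C (shift k B) + C (shift k D) * X

theorem derivative_pencil (B D : Matrix (Fin 2) (Fin 2) S[X]) (k : ℕ) :
    derivative (pencil B D k) = C (shift k D) := by
  simp [pencil]

theorem natDegree_pencil_le (B D : Matrix (Fin 2) (Fin 2) S[X]) (k : ℕ) :
    (pencil B D k).natDegree ≤ 1 := by
  rw [pencil, add_comm]
  exact natDegree_linear_le

theorem hasWeight_coeff_pencil {n : ℕ} {B D : Matrix (Fin 2) (Fin 2) S[X]} (hB : HasWeight n B)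
    (hD : HasWeight n D) (k l : ℕ) : HasWeight n ((pencil B D k).coeff l) := by
  rcases l with _ | _ | l
  · simpa [pencil, shift] using hB.taylor (k : S)
  · simpa [pencil, shift, coeff_C] using hD.taylor (k : S)
  · rw [coeff_eq_zero_of_natDegree_lt ((natDegree_pencil_le B D k).trans_lt (by omega))]
    exact hasWeight_zero n

theorem coeff_descProd_pencil_shift (B D : Matrix (Fin 2) (Fin 2) S[X]) (j n m : ℕ) :
    (descProd (fun k => pencil B D (k + j)) n).coeff m =
      shift j ((descProd (pencil B D) n).coeff m) := by
  let φ : Matrix (Fin 2) (Fin 2) S[X] →+* Matrix (Fin 2) (Fin 2) S[X] :=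
    ((taylorAlgHom (j : S)).mapMatrix : Matrix (Fin 2) (Fin 2) S[X] →ₐ[S] _)
  have hφ : ∀ M, φ M = shift j M := fun _ => rfl
  have h := map_descProd (pencil B D) (mapRingHom φ).toMonoidHom n
  have h2 : (fun k => pencil B D (k + j)) =
      fun k => (mapRingHom φ).toMonoidHom (pencil B D k) := by
    funext k
    simp [pencil, hφ, shift_shift]
  rw [h2, ← h, ← hφ]
  simp

variable (p : ℕ) [CharP S p]

theorem trace_coeff_derivative_descProd_pencil (B D : Matrix (Fin 2) (Fin 2) S[X]) (m : ℕ) :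
    ((derivative (descProd (pencil B D) p)).coeff m).trace =
      ∑ j ∈ Finset.range p, taylor (j : S)
        (D * (descProd (fun k => pencil B D (k + 1)) (p - 1)).coeff m).trace := by
  rw [derivative_descProd, finsetSum_coeff, Matrix.trace_sum]
  refine Finset.sum_congr rfl fun j hj => ?_
  rw [Finset.mem_range] at hj
  have hper : descProd (pencil B D) j = descProd (fun k => pencil B D (k + p)) j :=
    congrArg (fun F => descProd F j) (_root_.funext fun k => by simp only [pencil, shift_char])
  have hcyc := descProd_add (fun k => pencil B D (k + (j + 1))) (p - 1 - j) j
  have hidx : ∀ k, k + (p - 1 - j) + (j + 1) = k + p := fun k => by omega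
  simp only [hidx] at hcyc
  rw [trace_coeff_mul_comm, mul_assoc, hper, ← hcyc, derivative_pencil, coeff_C_mul,
    coeff_descProd_pencil_shift, coeff_descProd_pencil_shift, ← trace_shift,
    show p - 1 - j + j = p - 1 by omega, add_comm j 1, ← shift_shift]
  rw [shift_mul]

/-- In characteristic `p`, the cyclic trace is additive modulo polynomials of degree less
than `p`, as long as one summand has weight at most `3` and the other at most `2`. -/
theorem coeff_cyclicTrace_add [Fact p.Prime] [IsDomain S] {B D : Matrix (Fin 2) (Fin 2) S[X]}
    (hB : HasWeight 3 B) (hD : HasWeight 2 D) {i : ℕ} (hi : p ≤ i) :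
    (cyclicTrace p (B + D)).coeff i =
      (cyclicTrace p B).coeff i + (cyclicTrace p D).coeff i := by
  have hp := (Fact.out : p.Prime)
  set P := descProd (pencil B D) p with hP
  have hmid : ∀ m, m + 1 < p → (P.coeff (m + 1)).trace.coeff i = 0 := by
    intro m hm
    have h := trace_coeff_derivative_descProd_pencil p B D m
    have hw : HasWeight (2 + (p - 1) * 3)
        (D * (descProd (fun k => pencil B D (k + 1)) (p - 1)).coeff m) :=
      hD.mul (HasWeight.coeff_descProd
        (fun k l => hasWeight_coeff_pencil hB (hD.mono (by omega)) (k + 1) l) _ _)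
    have hdeg : (D * (descProd (fun k => pencil B D (k + 1)) (p - 1)).coeff m).trace.natDegree
        < 2 * p - 1 := by
      have h2 := hp.two_le
      rw [Nat.lt_iff_le_pred (by omega), natDegree_le_iff_coeff_eq_zero]
      intro k hk
      rw [Matrix.trace_fin_two, coeff_add, hw 0 0 k (by simp; omega),
        hw 1 1 k (by simp; omega), add_zero]
    have h0 := congrArg (fun q => coeff q i) h
    simp only [coeff_sum_taylor_eq_zero p hdeg hi] at h0
    rw [coeff_derivative] at h0
    have hcast : ((m : Matrix (Fin 2) (Fin 2) S[X]) + 1) = ((m + 1 : ℕ) : S[X]) • 1 := by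
      rw [← Nat.cast_succ, Nat.cast_smul_eq_nsmul, nsmul_one]
    rw [← hP, hcast, mul_smul_comm, mul_one, Matrix.trace_smul, smul_eq_mul, ← C_eq_natCast,
      coeff_C_mul] at h0
    refine (mul_eq_zero.1 h0).resolve_left fun hz => ?_
    exact absurd (Nat.le_of_dvd (by omega) ((CharP.cast_eq_zero_iff S p _).1 hz)) (by omega)
  have hlen : ((List.range p).reverse.map (pencil B D)).length * 1 = p := by simp
  have hdegP : P.natDegree ≤ p := by
    have h : ∀ n, (descProd (pencil B D) n).natDegree ≤ n := by
      intro n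
      induction n with
      | zero => simp
      | succ n ih =>
        rw [descProd_succ, add_comm]
        exact natDegree_mul_le_of_le (natDegree_pencil_le B D n) ih
    exact h p
  have htop : P.coeff p = descProd (fun k => shift k D) p := by
    have h := coeff_list_prod_of_natDegree_le ((List.range p).reverse.map (pencil B D)) 1
      (by simpa using fun k _ => natDegree_pencil_le B D k)
    rw [hlen, List.map_map] at h
    rw [hP, descProd, h, descProd]
    congr 2
    funext k
    simp [pencil, coeff_C]
  have hbot : P.coeff 0 = descProd (fun k => shift k B) p := by
    have h : ∀ n, (descProd (pencil B D) n).coeff 0 = descProd (fun k => shift k B) n := by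
      intro n
      induction n with
      | zero => simp
      | succ n ih => rw [descProd_succ, mul_coeff_zero, ih, descProd_succ]; simp [pencil]
    exact h p
  have hone : P.eval 1 = descProd (fun k => shift k (B + D)) p := by
    have h := map_descProd (pencil B D) (eval₂RingHom'
      (RingHom.id (Matrix (Fin 2) (Fin 2) S[X])) 1 fun a => Commute.one_right _).toMonoidHom p
    rw [show (fun k => shift k (B + D)) = fun k => (pencil B D k).eval 1 by
      funext k; simp [pencil, shift_add]]
    exact h
  rw [eval_eq_sum_range' (Nat.lt_succ_of_le hdegP), Finset.sum_range_succ] at hone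
  obtain ⟨n, hn⟩ : ∃ n, p = n + 1 := ⟨p - 1, by have := hp.two_le; omega⟩
  rw [show Finset.range p = Finset.range (n + 1) by rw [hn], Finset.sum_range_succ'] at hone
  simp only [one_pow, mul_one] at hone
  rw [cyclicTrace, ← hone, Matrix.trace_add, Matrix.trace_add, coeff_add, coeff_add,
    Matrix.trace_sum, finsetSum_coeff, Finset.sum_eq_zero, hbot, htop, zero_add]
  · rfl
  · intro m hm
    rw [Finset.mem_range] at hm
    exact hmid m (by omega)

end Additivity

section CyclicTrace

variable {S : Type*} [CommRing S]

theorem taylor_one_cyclicTrace {p : ℕ} (hp : 0 < p) [CharP S p] (M : Matrix (Fin 2) (Fin 2) S[X]) :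
    taylor 1 (cyclicTrace p M) = cyclicTrace p M := by
  have h1 : shift 1 (descProd (fun k => shift k M) p) = descProd (fun k => shift (k + 1) M) p := by
    have h := map_descProd (fun k => shift k M)
      ((taylorAlgHom ((1 : ℕ) : S)).mapMatrix (m := Fin 2)).toRingHom.toMonoidHom p
    refine h.trans (congrArg (fun F => descProd F p) (_root_.funext fun k => ?_))
    exact shift_shift 1 k M
  obtain ⟨n, rfl⟩ : ∃ n, p = n + 1 := ⟨p - 1, by omega⟩
  have h2 : shift (n + 1) M = shift 0 M := by simpa using shift_char (n + 1) 0 M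
  have h3 := descProd_add (fun k => shift k M) 1 n
  simp only [descProd_succ _ 0, descProd_zero, mul_one] at h3
  rw [cyclicTrace, ← Nat.cast_one, ← trace_shift, h1, descProd_succ, h2, Matrix.trace_mul_comm,
    ← h3, add_comm]

/-- Cyclic traces are invariant under gauge transformations. -/
theorem cyclicTrace_eq_of_gauge (p : ℕ) [CharP S p] {M N L L' : Matrix (Fin 2) (Fin 2) S[X]}
    (hL : L' * L = 1) (h : shift 1 L * M = N * L) : cyclicTrace p M = cyclicTrace p N := by
  have hn : ∀ n, shift n L * descProd (fun k => shift k M) n =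
      descProd (fun k => shift k N) n * L := by
    intro n
    induction n with
    | zero => simp [shift_zero]
    | succ n ih =>
      rw [descProd_succ, descProd_succ, mul_assoc, ← ih, ← mul_assoc, ← mul_assoc, ← shift_mul,
        ← h, shift_mul, shift_shift, add_comm]
  have hp := hn p
  have hLp : shift p L = L := by simpa [shift_zero] using shift_char p 0 L
  rw [hLp] at hp
  have hL2 : L * L' = 1 := mul_eq_one_comm.1 hL
  rw [cyclicTrace, cyclicTrace, ← mul_one (descProd (fun k => shift k N) p), ← hL2, ← mul_assoc,
    ← hp, Matrix.trace_mul_comm, ← mul_assoc, hL, one_mul]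

/-- An odd cyclic product of antidiagonal matrices has zero trace. -/
theorem cyclicTrace_antidiagonal {p : ℕ} (hp : Odd p) (b c : S[X]) :
    cyclicTrace p !![0, b; c, 0] = 0 := by
  have h : ∀ n, ∀ i j : Fin 2, Odd (n + i + j : ℕ) →
      descProd (fun k => shift k !![0, b; c, 0]) n i j = 0 := by
    intro n
    induction n with
    | zero =>
      intro i j hij
      fin_cases i <;> fin_cases j <;> simp_all [Nat.odd_iff]
    | succ n ih =>
      intro i j hij
      rw [descProd_succ, Matrix.mul_apply, Fin.sum_univ_two]
      fin_cases i
      · rw [ih 1 j (by simpa [add_comm, add_left_comm, add_assoc] using hij)]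
        simp [shift]
      · rw [ih 0 j (by simp at hij ⊢; grind)]
        simp [shift]
  rw [cyclicTrace, Matrix.trace_fin_two, h p 0 0 (by simpa using hp),
    h p 1 1 (by simp; grind), add_zero]

theorem coeff_cyclicTrace_linear {p i : ℕ} (hp : 0 < p) (hi : p ≤ i) (a b c d e t : S) :
    (cyclicTrace p !![C a, C b; C c * X + C d, C t * X + C e]).coeff i =
      if i = p then t ^ p else 0 := by
  set D : Matrix (Fin 2) (Fin 2) S[X] := !![C a, C b; C c * X + C d, C t * X + C e] with hD
  have hfac : ∀ k, matPolyEquiv (shift k D) =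
      C !![a, b; c * k + d, t * k + e] + C !![0, 0; c, t] * X := by
    intro k
    ext l i j
    rw [matPolyEquiv_coeff_apply]
    rcases l with _ | _ | l <;> fin_cases i <;> fin_cases j <;>
      simp [hD, shift, taylor_apply, coeff_C, mul_add, coeff_X]
  have hdeg : ∀ k, (matPolyEquiv (shift k D)).natDegree ≤ 1 := by
    intro k
    rw [hfac, add_comm]
    exact natDegree_linear_le
  have hprod := map_descProd (fun k => shift k D)
    (matPolyEquiv (R := S) (n := Fin 2)).toRingEquiv.toRingHom.toMonoidHom
  change ∀ n, matPolyEquiv _ = descProd (fun k => matPolyEquiv (shift k D)) n at hprod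
  have hdegP : ∀ n, (descProd (fun k => matPolyEquiv (shift k D)) n).natDegree ≤ n := by
    intro n
    induction n with
    | zero => simp
    | succ n ih =>
      rw [descProd_succ, add_comm]
      exact natDegree_mul_le_of_le (hdeg n) ih
  have htop : ∀ n, (descProd (fun k => matPolyEquiv (shift k D)) (n + 1)).coeff (n + 1) =
      t ^ n • !![0, 0; c, t] := by
    intro n
    have h : ∀ n, (descProd (fun k => matPolyEquiv (shift k D)) n).coeff n =
        !![0, 0; c, t] ^ n := by
      intro n
      induction n with
      | zero => simp
      | succ n ih =>
        rw [descProd_succ, add_comm, coeff_mul_add_eq_of_natDegree_le (hdeg n) (hdegP n), ih,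
          pow_add, pow_one, hfac]
        simp [coeff_C]
    rw [h]
    induction n with
    | zero => simp
    | succ n ih =>
      rw [pow_succ, ih]
      ext i j
      fin_cases i <;> fin_cases j <;> simp [Matrix.mul_apply, Fin.sum_univ_two] <;> ring
  rw [cyclicTrace, Matrix.trace_fin_two, coeff_add, ← matPolyEquiv_coeff_apply,
    ← matPolyEquiv_coeff_apply, hprod]
  split_ifs with h
  · obtain ⟨n, rfl⟩ : ∃ n, p = n + 1 := ⟨p - 1, by omega⟩
    rw [h, htop]
    simp [pow_succ]
  · rw [coeff_eq_zero_of_natDegree_lt ((hdegP p).trans_lt (by omega))]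
    simp

end CyclicTrace

section Lax

variable (p : ℕ)

theorem shift_AM (k : ℕ) :
    shift k (AM p (C : R p →+* (R p)[X]) X) = AM p C (X + C (k : R p)) := by
  ext i j : 1
  simp [shift, AM, taylor_apply]
  ring

theorem Ip_eq_trace_descProd :
    Ip p = (descProd (fun k : ℕ => AM p (RingHom.id (R p)) (k : R p)) p).trace := by
  simp [Ip, descProd, ← List.map_eq_flatMap, Function.comp_def]

theorem chi_eq_trace_descProd :
    chi p = (descProd (fun k : ℕ => AM p C (X + C (k : R p))) p).trace := by
  simp [chi, descProd, ← List.map_eq_flatMap, Function.comp_def]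

theorem chi_eq_cyclicTrace : chi p = cyclicTrace p (AM p C X) := by
  simp only [cyclicTrace, shift_AM, chi_eq_trace_descProd]

theorem eval_zero_chi : (chi p).eval 0 = Ip p := by
  have h := map_descProd (fun k : ℕ => AM p (C : R p →+* (R p)[X]) (X + C (k : R p)))
    ((evalRingHom (0 : R p)).mapMatrix (m := Fin 2)).toMonoidHom p
  have hk : ∀ k : ℕ, (evalRingHom (0 : R p)).mapMatrix (AM p C (X + C (k : R p))) =
      AM p (RingHom.id (R p)) (k : R p) := by
    intro k
    ext i j : 1
    simp [AM]
  change (evalRingHom (0 : R p)).mapMatrix _ = descProd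
    (fun k : ℕ => (evalRingHom (0 : R p)).mapMatrix (AM p C (X + C (k : R p)))) p at h
  simp only [hk] at h
  rw [Ip_eq_trace_descProd, chi_eq_trace_descProd, ← h]
  simp [Matrix.trace_fin_two]

/-- A gauge transformation lowers the weight of the Lax matrix to `3` and displays it as the
sum of an antidiagonal part and a linear part. -/
theorem exists_cyclicTrace_AM_eq [CharP (R p) p] : ∃ a b c d e : R p,
    cyclicTrace p (AM p C X) =
      cyclicTrace p (!![0, X; X ^ 2, 0] + !![C a, C b; C c * X + C d, C (tP p) * X + C e]) := by
  refine ⟨-(a1P p) * gP p + fP p * gP p ^ 2, -(fP p * gP p),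
    hP p + tP p * (-(a1P p) * gP p + fP p * gP p ^ 2 - tP p * fP p ^ 2 * gP p ^ 2
      - (-(a2P p) * fP p - fP p ^ 2 * gP p - tP p * fP p * gP p) - tP p * fP p * gP p),
    fP p * gP p * hP p - a1P p * a2P p
      + (tP p + tP p * fP p * gP p) *
        (-(a1P p) * gP p + fP p * gP p ^ 2 - tP p * fP p ^ 2 * gP p ^ 2)
      - tP p * fP p * gP p * (-(a2P p) * fP p - fP p ^ 2 * gP p - tP p * fP p * gP p),
    -(a2P p) * fP p - fP p ^ 2 * gP p - tP p * fP p * gP p, ?_⟩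
  apply cyclicTrace_eq_of_gauge p (L := !![1, 0; C (tP p) * X + C (tP p * fP p * gP p), 1])
    (L' := !![1, 0; -(C (tP p) * X + C (tP p * fP p * gP p)), 1])
  · ext i j : 1
    fin_cases i <;> fin_cases j <;> simp [Matrix.mul_apply, Fin.sum_univ_two]
  · ext i j : 1
    fin_cases i <;> fin_cases j <;>
      simp [Matrix.mul_apply, Fin.sum_univ_two, shift, AM, A0, A1, A2, A3, taylor_apply] <;> ring

theorem hasWeight_antidiagonal {S : Type*} [CommRing S] :
    HasWeight 3 (!![0, X; X ^ 2, 0] : Matrix (Fin 2) (Fin 2) S[X]) := by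
  intro i j k hk
  fin_cases i <;> fin_cases j <;> simp [coeff_X, coeff_X_pow] at hk ⊢ <;> omega

theorem hasWeight_linear {S : Type*} [CommRing S] (a b c d e t : S) :
    HasWeight 2 (!![C a, C b; C c * X + C d, C t * X + C e] : Matrix (Fin 2) (Fin 2) S[X]) := by
  intro i j k hk
  rcases k with _ | _ | k <;> fin_cases i <;> fin_cases j <;>
    simp at hk ⊢

theorem coeff_chi (hp : p.Prime) (hodd : p ≠ 2) {i : ℕ} (hi : p ≤ i) :
    (chi p).coeff i = if i = p then tP p ^ p else 0 := by
  have : Fact p.Prime := ⟨hp⟩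
  obtain ⟨a, b, c, d, e, h⟩ := exists_cyclicTrace_AM_eq p
  rw [chi_eq_cyclicTrace, h,
    coeff_cyclicTrace_add p hasWeight_antidiagonal (hasWeight_linear a b c d e _) hi,
    cyclicTrace_antidiagonal (hp.odd_of_ne_two hodd), coeff_zero, zero_add,
    coeff_cyclicTrace_linear hp.pos hi]

end Lax

end Polynomial.LaxTrace

/-- For an odd prime `p`, `χ_p(Z) = I_p − t^p·Z + t^p·Z^p` in `R[Z]`. -/
theorem chi_explicit_odd (p : ℕ) (hp : p.Prime) (hodd : p ≠ 2) :
    chi p = Polynomial.C (Ip p) - Polynomial.C (tP p ^ p) * Polynomial.X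
      + Polynomial.C (tP p ^ p) * Polynomial.X ^ p := by
  have : Fact p.Prime := ⟨hp⟩
  set q := chi p + Polynomial.C (tP p ^ p) * Polynomial.X
    - Polynomial.C (tP p ^ p) * Polynomial.X ^ p with hq
  have hdeg : q.natDegree < p := by
    rw [Nat.lt_iff_le_pred hp.pos, Polynomial.natDegree_le_iff_coeff_eq_zero]
    intro i hi
    have hi' : p ≤ i := by omega
    have h1 : 1 ≠ i := by have := hp.two_le; omega
    rw [hq, Polynomial.coeff_sub, Polynomial.coeff_add,
      Polynomial.LaxTrace.coeff_chi p hp hodd hi']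
    simp only [Polynomial.coeff_C_mul, Polynomial.coeff_X, Polynomial.coeff_X_pow, h1]
    simp
  have hinv : Polynomial.taylor 1 q = q := by
    have hchi : Polynomial.taylor 1 (chi p) = chi p := by
      rw [Polynomial.LaxTrace.chi_eq_cyclicTrace,
        Polynomial.LaxTrace.taylor_one_cyclicTrace hp.pos]
    have hX : (Polynomial.X + 1 : Polynomial (R p)) ^ p = Polynomial.X ^ p + 1 := by
      rw [add_pow_char, one_pow]
    rw [hq, map_sub, map_add, hchi]
    simp [Polynomial.taylor_apply, hX]
    ring
  have hconst := Polynomial.LaxTrace.eq_C_of_taylor_one_eq p hdeg hinv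
  have hzero : q.eval 0 = Ip p := by
    simp [hq, Polynomial.LaxTrace.eval_zero_chi, hp.ne_zero]
  rw [hzero] at hconst
  linear_combination hconst
end

section
/- Let p = 2. Then χ₂(Z) = C(I₂) + C(1 + t²)·(Z + Z²) in R[Z], where C : R → R[Z] is the constant-polynomial embedding; that is, the coefficient of Z⁰ in χ₂ is I₂, the coefficients of Z¹ and Z² are both 1 + t², and all other coefficients vanish. -/
open MvPolynomial

/-- `χ₂(Z) = Tr[A(Z + 1)·A(Z)] ∈ R[Z]` for `p = 2`. -/
noncomputable def chi2 : Polynomial (R 2) :=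
  Matrix.trace (((List.range 2).reverse.map
    (fun k => AM 2 (Polynomial.C : R 2 →+* Polynomial (R 2))
      (Polynomial.X + Polynomial.C (k : R 2)))).prod)

/-- `χ₂(Z) = I₂ + (1 + t²)·(Z + Z²)` in `R[Z]`. -/
theorem chi_explicit_two :
    chi2 = Polynomial.C (Ip 2)
      + Polynomial.C (1 + tP 2 ^ 2) * (Polynomial.X + Polynomial.X ^ 2) := by
  have two_eq_zero : (2 : Polynomial (R 2)) = 0 := CharTwo.two_eq_zero
  simp only [chi2, Ip, AM, A0, A1, A2, A3, hP, List.range_succ, List.range_zero, List.nil_append,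
    List.cons_append, List.reverse_cons, List.reverse_nil, List.map_cons, List.map_nil,
    List.bind_eq_flatMap, List.pure_def, List.flatMap_cons, List.flatMap_nil, List.prod_cons,
    List.prod_nil, mul_one, Matrix.trace_fin_two, Matrix.mul_apply,
    Fin.sum_univ_two, Matrix.add_apply, Matrix.smul_apply, Matrix.map_apply, Matrix.of_apply,
    Matrix.cons_val_zero, Matrix.cons_val_one, Matrix.cons_val', Matrix.cons_val_fin_one,
    smul_eq_mul, RingHom.id_apply, Nat.cast_zero, Nat.cast_one, map_add, map_sub, map_mul,
    map_neg, map_pow, map_one, map_zero]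
  generalize Polynomial.C (fP 2) = f, Polynomial.C (gP 2) = g, Polynomial.C (a1P 2) = a,
    Polynomial.C (a2P 2) = b, Polynomial.C (tP 2) = t, (Polynomial.X : Polynomial (R 2)) = z
  grind
end
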